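/- arXiv:1707.03033 — 2 statements merged into one kernel-verified Lean document; each statement's English description precedes it below -/
import Mathlib

section
/- Let (𝔤, 𝔥, ▷, ◁) be a matched pair of Lie algebras over a field k. Then the actions extend uniquely to a matched pair of cocommutative Hopf algebras (U(𝔤), U(𝔥), ▷, ◁) between the universal enveloping algebras, and consequently the tensor product coalgebra U(𝔤) ⊗ U(𝔥), equipped with the bicrossed product multiplication (a ⊗ x)(b ⊗ y) = a(x₍₁₎ ▷ b₍₁₎) ⊗ (x₍₂₎ ◁ b₍₂₎)y and the second multiplication (a ⊗ x) ∘ (b ⊗ y) = ab ⊗ yx, is a cocommutative Hopf brace. -/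
/-! Common definitions for formalizing "Constructing Hopf braces" (Agore). -/

open TensorProduct LinearMap

namespace HopfBraceNL

universe u

variable (k : Type u) [Field k]

section HopfStr

variable (V : Type u) [AddCommGroup V] [Module k V] [Coalgebra k V]

/-- The coalgebra `V` is cocommutative. -/
def IsCocomm : Prop :=
  (TensorProduct.comm k V V).toLinearMap ∘ₗ (Coalgebra.comul (R := k) (A := V)) =
    Coalgebra.comul (R := k) (A := V)

/-- A Hopf algebra structure on the underlying coalgebra of `V`: a multiplication, unit and
antipode making `V` a Hopf algebra whose comultiplication and counit are the given ones. -/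
structure HopfStr where
  mul : V ⊗[k] V →ₗ[k] V
  one : V
  mul_assoc : ∀ a b c : V, mul (mul (a ⊗ₜ[k] b) ⊗ₜ[k] c) = mul (a ⊗ₜ[k] mul (b ⊗ₜ[k] c))
  one_mul : ∀ a : V, mul (one ⊗ₜ[k] a) = a
  mul_one : ∀ a : V, mul (a ⊗ₜ[k] one) = a
  comul_mul : ∀ a b : V,
    Coalgebra.comul (R := k) (mul (a ⊗ₜ[k] b)) =
      TensorProduct.map mul mul
        (TensorProduct.tensorTensorTensorComm k V V V V
          (Coalgebra.comul (R := k) a ⊗ₜ[k] Coalgebra.comul (R := k) b))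
  counit_mul : ∀ a b : V,
    Coalgebra.counit (R := k) (mul (a ⊗ₜ[k] b)) =
      Coalgebra.counit (R := k) a * Coalgebra.counit (R := k) b
  comul_one : Coalgebra.comul (R := k) one = one ⊗ₜ[k] one
  counit_one : Coalgebra.counit (R := k) one = 1
  antipode : V →ₗ[k] V
  antipode_left :
    mul ∘ₗ rTensor V antipode ∘ₗ Coalgebra.comul =
      toSpanSingleton k V one ∘ₗ Coalgebra.counit
  antipode_right :
    mul ∘ₗ lTensor V antipode ∘ₗ Coalgebra.comul =
      toSpanSingleton k V one ∘ₗ Coalgebra.counit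

variable {k V}

/-- The Hopf structure is commutative. -/
def HopfStr.IsComm (hs : HopfStr k V) : Prop :=
  ∀ x y : V, hs.mul (x ⊗ₜ[k] y) = hs.mul (y ⊗ₜ[k] x)

/-- The linear map `x ⊗ y ⊗ z ↦ (x₍₁₎ ∘ y)·S(x₍₂₎)·(x₍₃₎ ∘ z)` (Sweedler notation), the right
hand side of the Hopf brace compatibility condition, written point-free.  Here `m` and `S` are
the multiplication and antipode of the first Hopf structure and `m'` the multiplication of the
second one. -/
noncomputable def braceRHS (m : V ⊗[k] V →ₗ[k] V) (S : V →ₗ[k] V)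
    (m' : V ⊗[k] V →ₗ[k] V) : V ⊗[k] (V ⊗[k] V) →ₗ[k] V :=
  m ∘ₗ lTensor V m
    ∘ₗ TensorProduct.map m' (TensorProduct.map S m')
    ∘ₗ lTensor (V ⊗[k] V) (TensorProduct.assoc k V V V).toLinearMap
    ∘ₗ (TensorProduct.tensorTensorTensorComm k V (V ⊗[k] V) V V).toLinearMap
    ∘ₗ rTensor (V ⊗[k] V)
        ((lTensor V (Coalgebra.comul (R := k))) ∘ₗ (Coalgebra.comul (R := k) (A := V)))

variable (k V) in
/-- A Hopf brace on the coalgebra `V`: two Hopf algebra structures subject to the compatibility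
`x ∘ (y·z) = (x₍₁₎ ∘ y)·S(x₍₂₎)·(x₍₃₎ ∘ z)`. -/
structure HopfBrace where
  dot : HopfStr k V
  circ : HopfStr k V
  brace : circ.mul ∘ₗ lTensor V dot.mul = braceRHS dot.mul dot.antipode circ.mul

/-- A solution of the braid equation on `V ⊗ V`. -/
def SolvesBraid {W : Type u} [AddCommGroup W] [Module k W]
    (c : W ⊗[k] W →ₗ[k] W ⊗[k] W) : Prop :=
  letI c₁ : (W ⊗[k] W) ⊗[k] W →ₗ[k] (W ⊗[k] W) ⊗[k] W := rTensor W c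
  letI c₂ : (W ⊗[k] W) ⊗[k] W →ₗ[k] (W ⊗[k] W) ⊗[k] W :=
    (TensorProduct.assoc k W W W).symm.toLinearMap ∘ₗ lTensor W c ∘ₗ
      (TensorProduct.assoc k W W W).toLinearMap
  c₁ ∘ₗ c₂ ∘ₗ c₁ = c₂ ∘ₗ c₁ ∘ₗ c₂

end HopfStr

section Actions

variable {k}
variable {A H : Type u}
  [AddCommGroup A] [Module k A] [Coalgebra k A]
  [AddCommGroup H] [Module k H] [Coalgebra k H]

/-- `(x, a) ↦ (x₍₁₎ ⊗ a₍₁₎) ⊗ (x₍₂₎ ⊗ a₍₂₎)`, as an element. -/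
noncomputable def split (x : H) (a : A) : (H ⊗[k] A) ⊗[k] (H ⊗[k] A) :=
  TensorProduct.tensorTensorTensorComm k H H A A
    (Coalgebra.comul (R := k) x ⊗ₜ[k] Coalgebra.comul (R := k) a)

/-- `A` is a left module over the Hopf structure `hH` via `act`. -/
structure IsLeftModule (hH : HopfStr k H) (act : H ⊗[k] A →ₗ[k] A) : Prop where
  one_act : ∀ a : A, act (hH.one ⊗ₜ[k] a) = a
  mul_act : ∀ (x y : H) (a : A),
    act (hH.mul (x ⊗ₜ[k] y) ⊗ₜ[k] a) = act (x ⊗ₜ[k] act (y ⊗ₜ[k] a))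

/-- `A` is a left module over `hH`-op via `act`, i.e. `(xy) ▶ a = y ▶ (x ▶ a)`. -/
structure IsLeftOpModule (hH : HopfStr k H) (act : H ⊗[k] A →ₗ[k] A) : Prop where
  one_act : ∀ a : A, act (hH.one ⊗ₜ[k] a) = a
  mul_act : ∀ (x y : H) (a : A),
    act (hH.mul (x ⊗ₜ[k] y) ⊗ₜ[k] a) = act (y ⊗ₜ[k] act (x ⊗ₜ[k] a))

/-- The measuring conditions: `x ▶ (ab) = (x₍₁₎ ▶ a)(x₍₂₎ ▶ b)` and `x ▶ 1 = ε(x)1`. -/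
structure IsModuleAlgebraLaw (hA : HopfStr k A) (act : H ⊗[k] A →ₗ[k] A) : Prop where
  act_mul : ∀ (x : H) (a b : A),
    act (x ⊗ₜ[k] hA.mul (a ⊗ₜ[k] b)) =
      hA.mul (TensorProduct.map act act
        (TensorProduct.tensorTensorTensorComm k H H A A
          (Coalgebra.comul (R := k) x ⊗ₜ[k] (a ⊗ₜ[k] b))))
  act_one : ∀ x : H, act (x ⊗ₜ[k] hA.one) = Coalgebra.counit (R := k) x • hA.one

/-- `act` is a coalgebra map: `Δ(x ▶ a) = (x₍₁₎ ▶ a₍₁₎) ⊗ (x₍₂₎ ▶ a₍₂₎)`,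
`ε(x ▶ a) = ε(x)ε(a)`. -/
structure IsCoalgebraLaw (act : H ⊗[k] A →ₗ[k] A) : Prop where
  comul_act : ∀ (x : H) (a : A),
    Coalgebra.comul (R := k) (act (x ⊗ₜ[k] a)) = TensorProduct.map act act (split x a)
  counit_act : ∀ (x : H) (a : A),
    Coalgebra.counit (R := k) (act (x ⊗ₜ[k] a)) =
      Coalgebra.counit (R := k) x * Coalgebra.counit (R := k) a

/-- `(A, act)` is a left `hH`-module algebra. -/
structure IsLeftModuleAlgebra (hH : HopfStr k H) (hA : HopfStr k A)
    (act : H ⊗[k] A →ₗ[k] A) : Prop where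
  toIsLeftModule : IsLeftModule hH act
  toLaw : IsModuleAlgebraLaw hA act

/-- `(A, act)` is a left `hH`-module coalgebra. -/
structure IsLeftModuleCoalgebra (hH : HopfStr k H) (act : H ⊗[k] A →ₗ[k] A) : Prop where
  toIsLeftModule : IsLeftModule hH act
  toCoalgLaw : IsCoalgebraLaw act

/-- `(A, act)` is a left `hH`-module bialgebra. -/
structure IsLeftModuleBialgebra (hH : HopfStr k H) (hA : HopfStr k A)
    (act : H ⊗[k] A →ₗ[k] A) : Prop where
  toIsLeftModule : IsLeftModule hH act
  toLaw : IsModuleAlgebraLaw hA act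
  toCoalgLaw : IsCoalgebraLaw act

/-- `(A, act)` is a left `hH`-op-module bialgebra. -/
structure IsLeftOpModuleBialgebra (hH : HopfStr k H) (hA : HopfStr k A)
    (act : H ⊗[k] A →ₗ[k] A) : Prop where
  toIsLeftOpModule : IsLeftOpModule hH act
  toLaw : IsModuleAlgebraLaw hA act
  toCoalgLaw : IsCoalgebraLaw act

/-- `H` is a right module over the Hopf structure `hA` via `ract : H ⊗ A → H`. -/
structure IsRightModule (hA : HopfStr k A) (ract : H ⊗[k] A →ₗ[k] H) : Prop where
  act_one : ∀ x : H, ract (x ⊗ₜ[k] hA.one) = x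
  act_mul : ∀ (x : H) (a b : A),
    ract (x ⊗ₜ[k] hA.mul (a ⊗ₜ[k] b)) = ract (ract (x ⊗ₜ[k] a) ⊗ₜ[k] b)

/-- `ract` is a coalgebra map `H ⊗ A → H`. -/
structure IsRightCoalgebraLaw (ract : H ⊗[k] A →ₗ[k] H) : Prop where
  comul_act : ∀ (x : H) (a : A),
    Coalgebra.comul (R := k) (ract (x ⊗ₜ[k] a)) = TensorProduct.map ract ract (split x a)
  counit_act : ∀ (x : H) (a : A),
    Coalgebra.counit (R := k) (ract (x ⊗ₜ[k] a)) =
      Coalgebra.counit (R := k) x * Coalgebra.counit (R := k) a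

/-- `(H, ract)` is a right `hA`-module bialgebra:  in addition to the module and coalgebra
conditions, `(xy) ◁ a = (x ◁ a₍₁₎)(y ◁ a₍₂₎)` and `1 ◁ a = ε(a)1`. -/
structure IsRightModuleBialgebra (hA : HopfStr k A) (hH : HopfStr k H)
    (ract : H ⊗[k] A →ₗ[k] H) : Prop where
  toIsRightModule : IsRightModule hA ract
  mul_ract : ∀ (x y : H) (a : A),
    ract (hH.mul (x ⊗ₜ[k] y) ⊗ₜ[k] a) =
      hH.mul (TensorProduct.map ract ract
        (TensorProduct.tensorTensorTensorComm k H H A A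
          ((x ⊗ₜ[k] y) ⊗ₜ[k] Coalgebra.comul (R := k) a)))
  one_ract : ∀ a : A, ract (hH.one ⊗ₜ[k] a) = Coalgebra.counit (R := k) a • hH.one
  toCoalgLaw : IsRightCoalgebraLaw ract

/-- `(A, H, tri, quad)` is a matched pair of Hopf algebras. -/
structure IsMatchedPair (hA : HopfStr k A) (hH : HopfStr k H)
    (tri : H ⊗[k] A →ₗ[k] A) (quad : H ⊗[k] A →ₗ[k] H) : Prop where
  tri_module : IsLeftModule hH tri
  tri_coalg : IsCoalgebraLaw tri
  quad_module : IsRightModule hA quad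
  quad_coalg : IsRightCoalgebraLaw quad
  mp1 : ∀ x : H, tri (x ⊗ₜ[k] hA.one) = Coalgebra.counit (R := k) x • hA.one
  mp1' : ∀ a : A, quad (hH.one ⊗ₜ[k] a) = Coalgebra.counit (R := k) a • hH.one
  mp2 : ∀ (x : H) (a b : A),
    tri (x ⊗ₜ[k] hA.mul (a ⊗ₜ[k] b)) =
      hA.mul (lTensor A tri (TensorProduct.assoc k A H A
        ((TensorProduct.map tri quad (split x a)) ⊗ₜ[k] b)))
  mp3 : ∀ (x y : H) (a : A),
    quad (hH.mul (x ⊗ₜ[k] y) ⊗ₜ[k] a) =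
      hH.mul (rTensor H quad ((TensorProduct.assoc k H A H).symm
        (x ⊗ₜ[k] TensorProduct.map tri quad (split y a))))
  mp4 : ∀ (x : H) (a : A),
    TensorProduct.map quad tri (split x a) =
      TensorProduct.comm k A H (TensorProduct.map tri quad (split x a))

variable (k) in
/-- `(a ⊗ (u₁ ⊗ u₂)) ⊗ y ↦ mA (a ⊗ u₁) ⊗ mH (u₂ ⊗ y)`: the standard way to assemble
a multiplication on `A ⊗ H` from a middle term `u ∈ A ⊗ H`. -/
noncomputable def sandwich (mA : A ⊗[k] A →ₗ[k] A) (mH : H ⊗[k] H →ₗ[k] H) :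
    (A ⊗[k] (A ⊗[k] H)) ⊗[k] H →ₗ[k] A ⊗[k] H :=
  TensorProduct.map mA mH
    ∘ₗ (TensorProduct.assoc k (A ⊗[k] A) H H).toLinearMap
    ∘ₗ rTensor H (TensorProduct.assoc k A A H).symm.toLinearMap

variable (k) in
/-- `(m ⊗ n) ⊗ p ↦ (m ⊗ p) ⊗ n`. -/
noncomputable def rightComm (M N P : Type u) [AddCommGroup M] [Module k M]
    [AddCommGroup N] [Module k N] [AddCommGroup P] [Module k P] :
    (M ⊗[k] N) ⊗[k] P →ₗ[k] (M ⊗[k] P) ⊗[k] N :=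
  (TensorProduct.assoc k M P N).symm.toLinearMap
    ∘ₗ lTensor M (TensorProduct.comm k N P).toLinearMap
    ∘ₗ (TensorProduct.assoc k M N P).toLinearMap

/-- `(x, b) ↦ (x₍₁₎ ▷ b₍₁₎) ⊗ (x₍₂₎ ◁ b₍₂₎)`. -/
noncomputable def matchedEl (tri : H ⊗[k] A →ₗ[k] A) (quad : H ⊗[k] A →ₗ[k] H)
    (x : H) (b : A) : A ⊗[k] H :=
  TensorProduct.map tri quad (split x b)

/-- `(x, b) ↦ (x₍₁₎ ▷ b) ⊗ x₍₂₎`. -/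
noncomputable def smashEl (tri : H ⊗[k] A →ₗ[k] A) (x : H) (b : A) : A ⊗[k] H :=
  rTensor H tri (rightComm k H H A (Coalgebra.comul (R := k) x ⊗ₜ[k] b))

/-- `(x, b) ↦ b₍₁₎ ⊗ (x ◁ b₍₂₎)`. -/
noncomputable def rsmashEl (ract : H ⊗[k] A →ₗ[k] H) (x : H) (b : A) : A ⊗[k] H :=
  lTensor A ract (TensorProduct.leftComm k H A A (x ⊗ₜ[k] Coalgebra.comul (R := k) b))

end Actions

section Points

open Coalgebra

variable {k}
variable {C C' V W X Y Z : Type u}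
  [AddCommGroup C] [Module k C] [Coalgebra k C]
  [AddCommGroup C'] [Module k C'] [Coalgebra k C']
  [AddCommGroup V] [Module k V]
  [AddCommGroup W] [Module k W]
  [AddCommGroup X] [Module k X]
  [AddCommGroup Y] [Module k Y]
  [AddCommGroup Z] [Module k Z]

/-- `c ↦ f c₍₁₎ ⊗ g c₍₂₎`. -/
noncomputable def pair (f : C →ₗ[k] V) (g : C →ₗ[k] W) : C →ₗ[k] V ⊗[k] W :=
  TensorProduct.map f g ∘ₗ comul

theorem map_comp_pair (u : V →ₗ[k] X) (v : W →ₗ[k] Y) (f : C →ₗ[k] V) (g : C →ₗ[k] W) :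
    TensorProduct.map u v ∘ₗ pair f g = pair (u ∘ₗ f) (v ∘ₗ g) := by
  simp only [pair, ← LinearMap.comp_assoc, TensorProduct.map_comp]

theorem lTensor_comp_pair (v : W →ₗ[k] Y) (f : C →ₗ[k] V) (g : C →ₗ[k] W) :
    lTensor V v ∘ₗ pair f g = pair f (v ∘ₗ g) :=
  map_comp_pair _ _ _ _

theorem rTensor_comp_pair (u : V →ₗ[k] X) (f : C →ₗ[k] V) (g : C →ₗ[k] W) :
    rTensor W u ∘ₗ pair f g = pair (u ∘ₗ f) g :=
  map_comp_pair _ _ _ _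

theorem pair_comp (f : C →ₗ[k] V) (g : C →ₗ[k] W) (c : C' →ₗc[k] C) :
    pair f g ∘ₗ (c : C' →ₗ[k] C) = pair (f ∘ₗ c) (g ∘ₗ c) := by
  have h : comul ∘ₗ (c : C' →ₗ[k] C) = TensorProduct.map (c : C' →ₗ[k] C) c ∘ₗ comul :=
    c.map_comp_comul.symm
  simp only [pair, LinearMap.comp_assoc, h]
  simp only [← LinearMap.comp_assoc, TensorProduct.map_comp]

theorem comul_comp [Coalgebra k V] (f : C →ₗc[k] V) :
    comul ∘ₗ (f : C →ₗ[k] V) = pair (f : C →ₗ[k] V) f :=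
  f.map_comp_comul.symm

theorem counit_comp [Coalgebra k V] (f : C →ₗc[k] V) :
    counit ∘ₗ (f : C →ₗ[k] V) = counit :=
  f.counit_comp

theorem assoc_comp_pair (f : C →ₗ[k] V) (g : C →ₗ[k] W) (h : C →ₗ[k] X) :
    (TensorProduct.assoc k V W X).toLinearMap ∘ₗ pair (pair f g) h = pair f (pair g h) := by
  have h1 : pair (pair f g) h = TensorProduct.map (TensorProduct.map f g) h ∘ₗ
      rTensor C comul ∘ₗ comul := by
    rw [← LinearMap.comp_assoc, LinearMap.map_comp_rTensor]; rfl
  have h2 : pair f (pair g h) = TensorProduct.map f (TensorProduct.map g h) ∘ₗ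
      lTensor C comul ∘ₗ comul := by
    rw [← LinearMap.comp_assoc, LinearMap.map_comp_lTensor]; rfl
  have h3 : (TensorProduct.assoc k V W X).toLinearMap ∘ₗ
      TensorProduct.map (TensorProduct.map f g) h =
      TensorProduct.map f (TensorProduct.map g h) ∘ₗ
        (TensorProduct.assoc k C C C).toLinearMap := by
    ext; simp
  rw [h1, h2, ← Coalgebra.coassoc, ← LinearMap.comp_assoc, h3, LinearMap.comp_assoc]

theorem assoc_symm_comp_pair (f : C →ₗ[k] V) (g : C →ₗ[k] W) (h : C →ₗ[k] X) :
    (TensorProduct.assoc k V W X).symm.toLinearMap ∘ₗ pair f (pair g h) =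
      pair (pair f g) h := by
  rw [← assoc_comp_pair, ← LinearMap.comp_assoc]
  simp

theorem comm_comp_pair [Coalgebra.IsCocomm k C] (f : C →ₗ[k] V) (g : C →ₗ[k] W) :
    (TensorProduct.comm k V W).toLinearMap ∘ₗ pair f g = pair g f := by
  have h : (TensorProduct.comm k V W).toLinearMap ∘ₗ TensorProduct.map f g =
      TensorProduct.map g f ∘ₗ (TensorProduct.comm k C C).toLinearMap := by
    ext; simp
  rw [pair, ← LinearMap.comp_assoc, h, LinearMap.comp_assoc, Coalgebra.comm_comp_comul]
  rfl

theorem tensorTensorTensorComm_comp_pair [Coalgebra.IsCocomm k C] (f : C →ₗ[k] V) (g : C →ₗ[k] W)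
    (h : C →ₗ[k] X) (i : C →ₗ[k] Y) :
    (TensorProduct.tensorTensorTensorComm k V W X Y).toLinearMap ∘ₗ pair (pair f g) (pair h i) =
      pair (pair f h) (pair g i) := by
  have e : (TensorProduct.tensorTensorTensorComm k V W X Y).toLinearMap =
      (TensorProduct.assoc k V X (W ⊗[k] Y)).symm.toLinearMap ∘ₗ
      lTensor V ((TensorProduct.assoc k X W Y).toLinearMap ∘ₗ
        rTensor Y (TensorProduct.comm k W X).toLinearMap ∘ₗ
        (TensorProduct.assoc k W X Y).symm.toLinearMap) ∘ₗ
      (TensorProduct.assoc k V W (X ⊗[k] Y)).toLinearMap := by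
    ext; simp
  simp only [e, LinearMap.comp_assoc, assoc_comp_pair, assoc_symm_comp_pair, lTensor_comp_pair,
    rTensor_comp_pair, comm_comp_pair]

theorem lid_comp_pair (g : C →ₗ[k] V) :
    (TensorProduct.lid k V).toLinearMap ∘ₗ pair counit g = g := by
  ext c
  have := congrArg (TensorProduct.map LinearMap.id g)
      (Coalgebra.rTensor_counit_comul (R := k) (A := C) c)
  have h2 : TensorProduct.map LinearMap.id g ∘ₗ rTensor C (counit (R := k) (A := C)) =
    TensorProduct.map (counit (R := k)) g := by simp [LinearMap.map_comp_rTensor]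
  simp only [pair, LinearMap.comp_apply, ← h2, this]
  simp

theorem rid_comp_pair (f : C →ₗ[k] V) :
    (TensorProduct.rid k V).toLinearMap ∘ₗ pair f counit = f := by
  ext c
  have := congrArg (TensorProduct.map f LinearMap.id)
      (Coalgebra.lTensor_counit_comul (R := k) (A := C) c)
  have h2 : TensorProduct.map f LinearMap.id ∘ₗ lTensor C (counit (R := k) (A := C)) =
    TensorProduct.map f (counit (R := k)) := by simp [LinearMap.map_comp_lTensor]
  simp only [pair, LinearMap.comp_apply, ← h2, this]
  simp

theorem pair_counit_left (u : k →ₗ[k] V) (g : C →ₗ[k] W) :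
    pair (u ∘ₗ counit) g = TensorProduct.mk k V W (u 1) ∘ₗ g := by
  conv_rhs => rw [← lid_comp_pair g]
  have : TensorProduct.mk k V W (u 1) ∘ₗ (TensorProduct.lid k W).toLinearMap = rTensor W u := by
    ext; simp
  rw [← LinearMap.comp_assoc, this, rTensor_comp_pair]

theorem pair_counit_right (f : C →ₗ[k] V) (u : k →ₗ[k] W) :
    pair f (u ∘ₗ counit) = (TensorProduct.mk k V W).flip (u 1) ∘ₗ f := by
  conv_rhs => rw [← rid_comp_pair f]
  have : (TensorProduct.mk k V W).flip (u 1) ∘ₗ (TensorProduct.rid k V).toLinearMap =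
      lTensor V u := by
    ext; simp
  rw [← LinearMap.comp_assoc, this, lTensor_comp_pair]

section Bundled

variable [Coalgebra k V] [Coalgebra k W] [Coalgebra k X] [Coalgebra k Y]

/-- The morphism of coalgebras into a tensor product with given components. -/
noncomputable def cpair [Coalgebra.IsCocomm k C] (f : C →ₗc[k] V) (g : C →ₗc[k] W) :
    C →ₗc[k] V ⊗[k] W :=
  (Coalgebra.TensorProduct.map f g).comp (comulCoalgHom k C)

@[simp]
theorem coe_cpair [Coalgebra.IsCocomm k C] (f : C →ₗc[k] V) (g : C →ₗc[k] W) :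
    (cpair f g : C →ₗ[k] V ⊗[k] W) = pair (f : C →ₗ[k] V) g :=
  rfl

variable (k V W) in
/-- The first projection `v ⊗ w ↦ ε(w) v`. -/
noncomputable def cfst : V ⊗[k] W →ₗc[k] V :=
  ((Coalgebra.TensorProduct.rid k k V : V ⊗[k] k ≃ₗc[k] V) : V ⊗[k] k →ₗc[k] V).comp
    (Coalgebra.TensorProduct.map (CoalgHom.id k V) (counitCoalgHom k W))

variable (k V W) in
/-- The second projection `v ⊗ w ↦ ε(v) w`. -/
noncomputable def csnd : V ⊗[k] W →ₗc[k] W :=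
  ((Coalgebra.TensorProduct.lid k W : k ⊗[k] W ≃ₗc[k] W) : k ⊗[k] W →ₗc[k] W).comp
    (Coalgebra.TensorProduct.map (counitCoalgHom k V) (CoalgHom.id k W))

theorem cfst_tmul (v : V) (w : W) : cfst k V W (v ⊗ₜ w) = counit (R := k) w • v := rfl

theorem csnd_tmul (v : V) (w : W) : csnd k V W (v ⊗ₜ w) = counit (R := k) v • w := rfl

theorem coe_cfst : (cfst k V W : V ⊗[k] W →ₗ[k] V) =
    (TensorProduct.rid k V).toLinearMap ∘ₗ lTensor V counit := by
  ext; rfl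

theorem coe_csnd : (csnd k V W : V ⊗[k] W →ₗ[k] W) =
    (TensorProduct.lid k W).toLinearMap ∘ₗ rTensor W counit := by
  ext; rfl

theorem cfst_comp_pair (f : C →ₗ[k] V) (g : C →ₗc[k] W) :
    (cfst k V W : V ⊗[k] W →ₗ[k] V) ∘ₗ pair f g = f := by
  rw [coe_cfst, LinearMap.comp_assoc, lTensor_comp_pair, counit_comp, rid_comp_pair]

theorem csnd_comp_pair (f : C →ₗc[k] V) (g : C →ₗ[k] W) :
    (csnd k V W : V ⊗[k] W →ₗ[k] W) ∘ₗ pair (f : C →ₗ[k] V) g = g := by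
  rw [coe_csnd, LinearMap.comp_assoc, rTensor_comp_pair, counit_comp, lid_comp_pair]

theorem pair_cfst_csnd :
    pair (cfst k V W : V ⊗[k] W →ₗ[k] V) (csnd k V W : V ⊗[k] W →ₗ[k] W) = LinearMap.id := by
  ext v w
  have h1 := congrArg (TensorProduct.map ((TensorProduct.rid k V).toLinearMap)
    ((TensorProduct.lid k W).toLinearMap)) (congrArg₂ (fun a b => a ⊗ₜ[k] b)
      (Coalgebra.lTensor_counit_comul (R := k) v) (Coalgebra.rTensor_counit_comul (R := k) w))
  have h2 : TensorProduct.map (cfst k V W : V ⊗[k] W →ₗ[k] V) (csnd k V W : V ⊗[k] W →ₗ[k] W) ∘ₗ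
      (TensorProduct.tensorTensorTensorComm k V V W W).toLinearMap =
      TensorProduct.map ((TensorProduct.rid k V).toLinearMap ∘ₗ lTensor V counit)
        ((TensorProduct.lid k W).toLinearMap ∘ₗ rTensor W counit) := by
    ext v v' w w'
    simp [cfst_tmul, csnd_tmul, TensorProduct.smul_tmul, TensorProduct.tmul_smul, smul_smul,
      mul_comm]
  have h3 := LinearMap.congr_fun h2 (comul v ⊗ₜ[k] comul w)
  refine h3.trans ?_
  simp

theorem eq_pair_of_comp [Coalgebra.IsCocomm k C] (f : C →ₗc[k] V ⊗[k] W) :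
    (f : C →ₗ[k] V ⊗[k] W) = pair (((cfst k V W).comp f : C →ₗc[k] V) : C →ₗ[k] V)
      (((csnd k V W).comp f : C →ₗc[k] W) : C →ₗ[k] W) := by
  conv_lhs => rw [← LinearMap.id_comp (f : C →ₗ[k] V ⊗[k] W), ← pair_cfst_csnd, pair_comp]
  rfl

theorem ext_pair [Coalgebra.IsCocomm k V] [Coalgebra.IsCocomm k W] {F G : V ⊗[k] W →ₗ[k] Z}
    (h : ∀ (C : Type u) [AddCommGroup C] [Module k C] [Coalgebra k C] [Coalgebra.IsCocomm k C]
      (f : C →ₗc[k] V) (g : C →ₗc[k] W),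
      F ∘ₗ pair (f : C →ₗ[k] V) g = G ∘ₗ pair (f : C →ₗ[k] V) g) : F = G := by
  have := h (V ⊗[k] W) (cfst k V W) (csnd k V W)
  rwa [pair_cfst_csnd] at this

end Bundled

end Points

section HopfPoints

open Coalgebra

variable {k}
variable {C C' V : Type u}
  [AddCommGroup C] [Module k C] [Coalgebra k C]
  [AddCommGroup C'] [Module k C'] [Coalgebra k C']
  [AddCommGroup V] [Module k V] [Coalgebra k V]

namespace HopfStr

variable (hs : HopfStr k V)

theorem mul_pair_assoc (f g h : C →ₗ[k] V) :
    hs.mul ∘ₗ pair (hs.mul ∘ₗ pair f g) h = hs.mul ∘ₗ pair f (hs.mul ∘ₗ pair g h) := by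
  have e : hs.mul ∘ₗ rTensor V hs.mul =
      hs.mul ∘ₗ lTensor V hs.mul ∘ₗ (TensorProduct.assoc k V V V).toLinearMap := by
    ext a b c
    exact hs.mul_assoc a b c
  rw [← rTensor_comp_pair, ← LinearMap.comp_assoc, e, LinearMap.comp_assoc, LinearMap.comp_assoc,
    assoc_comp_pair, lTensor_comp_pair]

theorem one_pair (f : C →ₗ[k] V) :
    hs.mul ∘ₗ pair (toSpanSingleton k V hs.one ∘ₗ counit) f = f := by
  rw [pair_counit_left]
  ext c
  simp [hs.one_mul]

theorem pair_one (f : C →ₗ[k] V) :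
    hs.mul ∘ₗ pair f (toSpanSingleton k V hs.one ∘ₗ counit) = f := by
  rw [pair_counit_right]
  ext c
  simp [hs.mul_one]

theorem antipode_pair (f : C →ₗc[k] V) :
    hs.mul ∘ₗ pair (hs.antipode ∘ₗ (f : C →ₗ[k] V)) f =
      toSpanSingleton k V hs.one ∘ₗ counit := by
  have := congrArg (· ∘ₗ (f : C →ₗ[k] V)) hs.antipode_left
  simpa only [LinearMap.comp_assoc, comul_comp, counit_comp, rTensor_comp_pair] using this

theorem pair_antipode (f : C →ₗc[k] V) :
    hs.mul ∘ₗ pair (f : C →ₗ[k] V) (hs.antipode ∘ₗ (f : C →ₗ[k] V)) =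
      toSpanSingleton k V hs.one ∘ₗ counit := by
  have := congrArg (· ∘ₗ (f : C →ₗ[k] V)) hs.antipode_right
  simpa only [LinearMap.comp_assoc, comul_comp, counit_comp, lTensor_comp_pair] using this

/-- The multiplication as a morphism of coalgebras. -/
noncomputable def cmul : V ⊗[k] V →ₗc[k] V where
  toLinearMap := hs.mul
  counit_comp := by
    ext a b
    simp [hs.counit_mul, mul_comm]
  map_comp_comul := by
    ext a b
    exact (hs.comul_mul a b).symm

/-- The constant point `c ↦ ε(c) 1`. -/
noncomputable def cone : C →ₗc[k] V :=
  CoalgHom.comp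
    { toSpanSingleton k V hs.one with
      counit_comp := by ext; simp [hs.counit_one]
      map_comp_comul := by ext; simp [hs.comul_one] }
    (counitCoalgHom k C)

/-- The multiplication of the tensor square. -/
theorem comul_comp_mul : comul ∘ₗ hs.mul = TensorProduct.map hs.mul hs.mul ∘ₗ
    (TensorProduct.tensorTensorTensorComm k V V V V).toLinearMap ∘ₗ
      TensorProduct.map comul comul := by
  ext a b
  exact hs.comul_mul a b

/-- The antipode of a cocommutative Hopf algebra as a morphism of coalgebras. -/
noncomputable def cantipode [Coalgebra.IsCocomm k V] : V →ₗc[k] V where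
  toLinearMap := hs.antipode
  counit_comp := by
    have h := congrArg (fun u => counit (R := k) ∘ₗ u) hs.antipode_left
    have e : counit (R := k) ∘ₗ hs.mul = (TensorProduct.rid k k).toLinearMap ∘ₗ
        TensorProduct.map counit counit := by
      ext a b; simp [hs.counit_mul, mul_comm]
    have e' : counit (R := k) ∘ₗ toSpanSingleton k V hs.one = LinearMap.id := by
      ext; simp [hs.counit_one]
    have h2 : rTensor V hs.antipode ∘ₗ comul = pair hs.antipode (LinearMap.id : V →ₗ[k] V) := rfl
    simp only [← LinearMap.comp_assoc, e, e'] at h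
    simpa only [LinearMap.comp_assoc, h2, map_comp_pair, LinearMap.comp_id, LinearMap.id_comp,
      rid_comp_pair] using h
  map_comp_comul := by
    let M : (V ⊗[k] V) ⊗[k] (V ⊗[k] V) →ₗ[k] V ⊗[k] V := TensorProduct.map hs.mul hs.mul ∘ₗ
      (TensorProduct.tensorTensorTensorComm k V V V V).toLinearMap
    have hM (f g h i : V →ₗ[k] V) : M ∘ₗ pair (pair f g) (pair h i) =
        pair (hs.mul ∘ₗ pair f h) (hs.mul ∘ₗ pair g i) := by
      rw [LinearMap.comp_assoc, tensorTensorTensorComm_comp_pair, map_comp_pair]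
    have hid : (comul : V →ₗ[k] V ⊗[k] V) = pair LinearMap.id LinearMap.id := by
      simp [pair]
    let u : V →ₗ[k] V := toSpanSingleton k V hs.one ∘ₗ counit
    have h1 : M ∘ₗ pair (comul ∘ₗ hs.antipode) (pair LinearMap.id LinearMap.id) = pair u u := by
      have h := congrArg (fun w => comul (R := k) ∘ₗ w) hs.antipode_left
      have e : (comul (R := k)) ∘ₗ toSpanSingleton k V hs.one ∘ₗ counit = pair u u := by
        rw [pair_counit_left]
        ext v
        simp [hs.comul_one, u]
      have h2 : rTensor V hs.antipode ∘ₗ comul = pair hs.antipode (LinearMap.id : V →ₗ[k] V) :=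
        rfl
      rw [← LinearMap.comp_assoc, comul_comp_mul, h2, LinearMap.comp_assoc, LinearMap.comp_assoc,
        map_comp_pair, e, LinearMap.comp_id, hid, ← LinearMap.comp_assoc] at h
      rw [hid]
      exact h
    have hr := hs.pair_antipode (CoalgHom.id k V)
    simp only [CoalgHom.id_toLinearMap, LinearMap.comp_id] at hr
    have hMa (f : V →ₗ[k] V ⊗[k] V) (a b c d : V →ₗ[k] V) :
        M ∘ₗ pair (M ∘ₗ pair f (pair a b)) (pair c d) =
          M ∘ₗ pair f (M ∘ₗ pair (pair a b) (pair c d)) := by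
      have e : M ∘ₗ rTensor (V ⊗[k] V) M = M ∘ₗ lTensor (V ⊗[k] V) M ∘ₗ
          (TensorProduct.assoc k (V ⊗[k] V) (V ⊗[k] V) (V ⊗[k] V)).toLinearMap := by
        ext a b c d e f
        simp [M, hs.mul_assoc]
      rw [← rTensor_comp_pair, ← lTensor_comp_pair, ← assoc_comp_pair f (pair a b) (pair c d),
        ← LinearMap.comp_assoc, e]
      rfl
    have hMu (f : V →ₗ[k] V ⊗[k] V) : M ∘ₗ pair f (pair u u) = f := by
      have e : pair u u = toSpanSingleton k _ (hs.one ⊗ₜ[k] hs.one) ∘ₗ counit (R := k) := by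
        rw [pair_counit_left]
        ext v
        simp [u]
      have e' : M ∘ₗ (TensorProduct.mk k (V ⊗[k] V) (V ⊗[k] V)).flip (hs.one ⊗ₜ[k] hs.one) =
          LinearMap.id := by
        ext a b
        simp [M, hs.mul_one]
      rw [e, pair_counit_right, ← LinearMap.comp_assoc]
      simp only [toSpanSingleton_apply, one_smul, e', LinearMap.id_comp]
    have hMu' (f g : V →ₗ[k] V) : M ∘ₗ pair (pair u u) (pair f g) = pair f g := by
      rw [hM, hs.one_pair, hs.one_pair]
    have key := hMa (comul ∘ₗ hs.antipode) LinearMap.id LinearMap.id hs.antipode hs.antipode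
    rw [h1, hMu', hM, hr, hMu] at key
    exact key

/-- The points of the Hopf algebra `V` with values in the cocommutative coalgebra `C`, that is,
the morphisms of coalgebras from `C` to `V`. -/
def Pt (_ : HopfStr k V) (C : Type u) [AddCommGroup C] [Module k C] [Coalgebra k C] : Type u :=
  C →ₗc[k] V

/-- The linear map underlying a point. -/
def Pt.lin {hs : HopfStr k V} (f : hs.Pt C) : C →ₗ[k] V := CoalgHom.toLinearMap f

theorem Pt.lin_injective {hs : HopfStr k V} : Function.Injective (Pt.lin : hs.Pt C → C →ₗ[k] V) :=
  CoalgHom.coe_linearMap_injective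

noncomputable instance [Coalgebra.IsCocomm k C] [Coalgebra.IsCocomm k V] : Group (hs.Pt C) where
  mul f g := hs.cmul.comp (cpair f g)
  one := hs.cone
  inv f := hs.cantipode.comp f
  mul_assoc f g h := Pt.lin_injective (hs.mul_pair_assoc (Pt.lin f) (Pt.lin g) (Pt.lin h))
  one_mul f := Pt.lin_injective (hs.one_pair (Pt.lin f))
  mul_one f := Pt.lin_injective (hs.pair_one (Pt.lin f))
  inv_mul_cancel f := Pt.lin_injective (hs.antipode_pair f)

variable [Coalgebra.IsCocomm k C] [Coalgebra.IsCocomm k V] {hs}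

theorem Pt.lin_mul (f g : hs.Pt C) : (f * g).lin = hs.mul ∘ₗ pair f.lin g.lin := rfl

theorem Pt.lin_one : (1 : hs.Pt C).lin = toSpanSingleton k V hs.one ∘ₗ counit := rfl

theorem Pt.lin_inv (f : hs.Pt C) : (f⁻¹).lin = hs.antipode ∘ₗ f.lin := rfl

end HopfStr

end HopfPoints

section MatchedGroups

/-- A matched pair of groups. -/
structure GroupMatchedPair (A H : Type*) [Group A] [Group H] where
  tri : H → A → A
  quad : H → A → H
  one_tri : ∀ a, tri 1 a = a
  mul_tri : ∀ h g a, tri (h * g) a = tri h (tri g a)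
  quad_one : ∀ h, quad h 1 = h
  quad_mul : ∀ h a b, quad h (a * b) = quad (quad h a) b
  tri_one : ∀ h, tri h 1 = 1
  one_quad : ∀ a, quad 1 a = 1
  tri_mul : ∀ h a b, tri h (a * b) = tri h a * tri (quad h a) b
  mul_quad : ∀ h g a, quad (h * g) a = quad h (tri g a) * quad g a

namespace GroupMatchedPair

variable {A H : Type*} [Group A] [Group H]

/-- The bicrossed product of a matched pair of groups. -/
@[ext]
structure Bicrossed (P : GroupMatchedPair A H) where
  left : A
  right : H

variable (P : GroupMatchedPair A H)

instance : Group (Bicrossed P) :=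
  letI : Mul (Bicrossed P) :=
    ⟨fun x y => ⟨x.left * P.tri x.right y.left, P.quad x.right y.left * y.right⟩⟩
  letI : One (Bicrossed P) := ⟨⟨1, 1⟩⟩
  letI : Inv (Bicrossed P) :=
    ⟨fun x => ⟨P.tri x.right⁻¹ x.left⁻¹, P.quad x.right⁻¹ x.left⁻¹⟩⟩
  Group.ofLeftAxioms
    (fun x y z => Bicrossed.ext
      (show (x.left * P.tri x.right y.left) * P.tri (P.quad x.right y.left * y.right) z.left =
          x.left * P.tri x.right (y.left * P.tri y.right z.left) by
        rw [P.tri_mul, P.mul_tri, mul_assoc])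
      (show P.quad (P.quad x.right y.left * y.right) z.left * z.right =
          P.quad x.right (y.left * P.tri y.right z.left) * (P.quad y.right z.left * z.right) by
        rw [P.quad_mul, P.mul_quad, mul_assoc]))
    (fun x => Bicrossed.ext
      (show 1 * P.tri 1 x.left = x.left by rw [P.one_tri, one_mul])
      (show P.quad 1 x.left * x.right = x.right by rw [P.one_quad, one_mul]))
    (fun x => Bicrossed.ext
      (show P.tri x.right⁻¹ x.left⁻¹ * P.tri (P.quad x.right⁻¹ x.left⁻¹) x.left = 1 by
        rw [← P.tri_mul, inv_mul_cancel, P.tri_one])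
      (show P.quad (P.quad x.right⁻¹ x.left⁻¹) x.left * x.right = 1 by
        rw [← P.quad_mul, inv_mul_cancel, P.quad_one, inv_mul_cancel]))

theorem mk_mul_mk (a b : A) (h g : H) :
    (⟨a, h⟩ * ⟨b, g⟩ : Bicrossed P) = ⟨a * P.tri h b, P.quad h b * g⟩ := rfl

theorem one_def : (1 : Bicrossed P) = ⟨1, 1⟩ := rfl

/-- The second multiplication `(a, h) ∘ (b, g) = (ab, gh)` is `x ∘ y = a y h` for `x = (a, h)`. -/
theorem circ_eq (a b : A) (h g : H) :
    (⟨a * b, g * h⟩ : Bicrossed P) = ⟨a, 1⟩ * ⟨b, g⟩ * ⟨1, h⟩ := by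
  simp [mk_mul_mk, P.one_tri, P.one_quad, P.tri_one, P.quad_one]

theorem mk_eq (a : A) (h : H) : (⟨a, h⟩ : Bicrossed P) = ⟨a, 1⟩ * ⟨1, h⟩ := by
  simp [mk_mul_mk, P.tri_one, P.one_quad]

/-- The brace identity `x ∘ (y z) = (x ∘ y) x⁻¹ (x ∘ z)`. -/
theorem brace (a b c : A) (h g l : H) :
    (⟨a * (b * P.tri g c), (P.quad g c * l) * h⟩ : Bicrossed P) =
      ⟨a * b, g * h⟩ * (⟨a, h⟩⁻¹ * ⟨a * c, l * h⟩) := by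
  rw [circ_eq P a (b * P.tri g c) h, ← mk_mul_mk, circ_eq P a b, circ_eq P a c, mk_eq P a h]
  group

/-- A matched pair of groups is obtained from a factorization with unique factors: if the
products `α a * β h` determine `a` and `h` and `β h * α a = α (tri h a) * β (quad h a)`, then
`tri` and `quad` form a matched pair. -/
def ofFactorization {M : Type*} [Monoid M] (α : A →* M) (β : H →* M) (tri : H → A → A)
    (quad : H → A → H)
    (hinj : ∀ a b h g, α a * β h = α b * β g → a = b ∧ h = g)
    (hex : ∀ h a, β h * α a = α (tri h a) * β (quad h a)) : GroupMatchedPair A H :=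
  have h1 (a : A) : tri 1 a = a ∧ quad 1 a = 1 := hinj _ _ _ _ (by simp [← hex])
  have h2 (h : H) : tri h 1 = 1 ∧ quad h 1 = h := hinj _ _ _ _ (by simp [← hex])
  have h3 (h g : H) (a : A) : tri (h * g) a = tri h (tri g a) ∧
      quad (h * g) a = quad h (tri g a) * quad g a := hinj _ _ _ _ (by
    rw [← hex, map_mul, map_mul, mul_assoc, hex, ← mul_assoc, hex, mul_assoc])
  have h4 (h : H) (a b : A) : tri h (a * b) = tri h a * tri (quad h a) b ∧
      quad h (a * b) = quad (quad h a) b := hinj _ _ _ _ (by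
    rw [← hex, map_mul, map_mul, ← mul_assoc, hex, mul_assoc, hex, mul_assoc])
  { tri := tri
    quad := quad
    one_tri := fun a => (h1 a).1
    mul_tri := fun h g a => (h3 h g a).1
    quad_one := fun h => (h2 h).2
    quad_mul := fun h a b => (h4 h a b).2
    tri_one := fun h => (h2 h).1
    one_quad := fun a => (h1 a).2
    tri_mul := fun h a b => (h4 h a b).1
    mul_quad := fun h g a => (h3 h g a).2 }

end GroupMatchedPair

end MatchedGroups

section OfPoints

open Coalgebra

variable {k}
variable {C V : Type u} [AddCommGroup C] [Module k C] [Coalgebra k C]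
  [AddCommGroup V] [Module k V] [Coalgebra k V]

/-- A Hopf algebra structure on a cocommutative coalgebra from a group structure on its points. -/
noncomputable def HopfStr.ofPoints [Coalgebra.IsCocomm k V] (m : V ⊗[k] V →ₗc[k] V)
    (e : k →ₗc[k] V) (S : V →ₗc[k] V)
    (assoc : ∀ (C : Type u) [AddCommGroup C] [Module k C] [Coalgebra k C] [Coalgebra.IsCocomm k C]
      (f g h : C →ₗc[k] V), m.comp (cpair (m.comp (cpair f g)) h) =
        m.comp (cpair f (m.comp (cpair g h))))
    (one_mul : ∀ (f : V →ₗc[k] V), m.comp (cpair (e.comp (counitCoalgHom k V)) f) = f)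
    (mul_one : ∀ (f : V →ₗc[k] V), m.comp (cpair f (e.comp (counitCoalgHom k V))) = f)
    (inv_mul : ∀ (f : V →ₗc[k] V), m.comp (cpair (S.comp f) f) = e.comp (counitCoalgHom k V))
    (mul_inv : ∀ (f : V →ₗc[k] V), m.comp (cpair f (S.comp f)) = e.comp (counitCoalgHom k V)) :
    HopfStr k V where
  mul := m
  one := e 1
  mul_assoc a b c := by
    have h := congrArg CoalgHom.toLinearMap <|
      assoc ((V ⊗[k] V) ⊗[k] V) ((cfst k V V).comp (cfst k (V ⊗[k] V) V))
        ((csnd k V V).comp (cfst k (V ⊗[k] V) V)) (csnd k (V ⊗[k] V) V)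
    simp only [CoalgHom.toLinearMap_eq_coe, CoalgHom.comp_toLinearMap, coe_cpair] at h
    have h1 : pair ((cfst k V V : _ →ₗ[k] V) ∘ₗ
          (cfst k (V ⊗[k] V) V : (V ⊗[k] V) ⊗[k] V →ₗ[k] V ⊗[k] V))
        ((csnd k V V : _ →ₗ[k] V) ∘ₗ (cfst k (V ⊗[k] V) V : (V ⊗[k] V) ⊗[k] V →ₗ[k] V ⊗[k] V)) =
        (cfst k (V ⊗[k] V) V : (V ⊗[k] V) ⊗[k] V →ₗ[k] V ⊗[k] V) := by
      rw [← pair_comp, pair_cfst_csnd, LinearMap.id_comp]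
    rw [← lTensor_comp_pair (m : V ⊗[k] V →ₗ[k] V) _
        (pair ((csnd k V V : _ →ₗ[k] V) ∘ₗ (cfst k (V ⊗[k] V) V : (V ⊗[k] V) ⊗[k] V →ₗ[k] V ⊗[k] V))
          (csnd k (V ⊗[k] V) V : _ →ₗ[k] V)),
      ← assoc_comp_pair, h1, ← rTensor_comp_pair, pair_cfst_csnd] at h
    exact LinearMap.congr_fun h ((a ⊗ₜ b) ⊗ₜ c)
  one_mul a := by
    have h := congrArg CoalgHom.toLinearMap (one_mul (CoalgHom.id k V))
    have h' := (pair_counit_left (e : k →ₗ[k] V) (LinearMap.id : V →ₗ[k] V))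
    simp only [CoalgHom.toLinearMap_eq_coe, CoalgHom.comp_toLinearMap, coe_cpair,
      counitCoalgHom_toLinearMap,
      CoalgHom.id_toLinearMap, h'] at h
    exact LinearMap.congr_fun h a
  mul_one a := by
    have h := congrArg CoalgHom.toLinearMap (mul_one (CoalgHom.id k V))
    have h' := (pair_counit_right (LinearMap.id : V →ₗ[k] V) (e : k →ₗ[k] V))
    simp only [CoalgHom.toLinearMap_eq_coe, CoalgHom.comp_toLinearMap, coe_cpair,
      counitCoalgHom_toLinearMap,
      CoalgHom.id_toLinearMap, h'] at h
    exact LinearMap.congr_fun h a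
  comul_mul a b := (CoalgHomClass.map_comp_comul_apply m (a ⊗ₜ b)).symm
  counit_mul a b := by
    refine (CoalgHomClass.counit_comp_apply m (a ⊗ₜ b)).trans ?_
    simp [mul_comm]
  comul_one := by
    simpa using (CoalgHomClass.map_comp_comul_apply e 1).symm
  counit_one := by simp
  antipode := S
  antipode_left := by
    have h := congrArg CoalgHom.toLinearMap (inv_mul (CoalgHom.id k V))
    have h' : (e : k →ₗ[k] V) = toSpanSingleton k V (e 1) := by ext; simp
    simp only [CoalgHom.toLinearMap_eq_coe, CoalgHom.comp_toLinearMap, coe_cpair,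
      counitCoalgHom_toLinearMap,
      CoalgHom.id_toLinearMap, h'] at h
    exact h
  antipode_right := by
    have h := congrArg CoalgHom.toLinearMap (mul_inv (CoalgHom.id k V))
    have h' : (e : k →ₗ[k] V) = toSpanSingleton k V (e 1) := by ext; simp
    simp only [CoalgHom.toLinearMap_eq_coe, CoalgHom.comp_toLinearMap, coe_cpair,
      counitCoalgHom_toLinearMap,
      CoalgHom.id_toLinearMap, h'] at h
    exact h

theorem braceRHS_comp_pair [Coalgebra.IsCocomm k C] (m m' : V ⊗[k] V →ₗ[k] V) (S : V →ₗ[k] V)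
    (x : C →ₗc[k] V) (y z : C →ₗ[k] V) :
    braceRHS m S m' ∘ₗ pair (x : C →ₗ[k] V) (pair y z) =
      m ∘ₗ pair (m' ∘ₗ pair (x : C →ₗ[k] V) y) (m ∘ₗ pair (S ∘ₗ (x : C →ₗ[k] V))
        (m' ∘ₗ pair (x : C →ₗ[k] V) z)) := by
  simp only [braceRHS, LinearMap.comp_assoc, rTensor_comp_pair, comul_comp, lTensor_comp_pair,
    tensorTensorTensorComm_comp_pair, map_comp_pair, assoc_comp_pair]

end OfPoints

section MatchedPoints

open Coalgebra HopfStr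

variable {k}
variable {A H : Type u}
  [AddCommGroup A] [Module k A] [Coalgebra k A]
  [AddCommGroup H] [Module k H] [Coalgebra k H]

/-- A left action by a coalgebra map as a morphism of coalgebras. -/
noncomputable def IsCoalgebraLaw.hom {act : H ⊗[k] A →ₗ[k] A} (h : IsCoalgebraLaw act) :
    H ⊗[k] A →ₗc[k] A where
  toLinearMap := act
  counit_comp := by
    ext x a
    simp [h.counit_act, mul_comm]
  map_comp_comul := by
    ext x a
    exact (h.comul_act x a).symm

/-- A right action by a coalgebra map as a morphism of coalgebras. -/
noncomputable def IsRightCoalgebraLaw.hom {act : H ⊗[k] A →ₗ[k] H} (h : IsRightCoalgebraLaw act) :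
    H ⊗[k] A →ₗc[k] H where
  toLinearMap := act
  counit_comp := by
    ext x a
    simp [h.counit_act, mul_comm]
  map_comp_comul := by
    ext x a
    exact (h.comul_act x a).symm

section

variable {tri : H ⊗[k] A →ₗ[k] A} {quad : H ⊗[k] A →ₗ[k] H}

@[simp]
theorem IsCoalgebraLaw.coe_hom (h : IsCoalgebraLaw tri) : (h.hom : H ⊗[k] A →ₗ[k] A) = tri := rfl

@[simp]
theorem IsRightCoalgebraLaw.coe_hom (h : IsRightCoalgebraLaw quad) :
    (h.hom : H ⊗[k] A →ₗ[k] H) = quad := rfl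

variable {C : Type u} [AddCommGroup C] [Module k C] [Coalgebra k C]

theorem comul_comp_pair [Coalgebra.IsCocomm k C] (h : C →ₗc[k] H) (a : C →ₗc[k] A) :
    comul ∘ₗ pair (h : C →ₗ[k] H) (a : C →ₗ[k] A) =
      pair (pair (h : C →ₗ[k] H) (a : C →ₗ[k] A)) (pair (h : C →ₗ[k] H) a) :=
  comul_comp (cpair h a)

theorem comul_comp_pair_lin [Coalgebra.IsCocomm k C] {hA : HopfStr k A} {hH : HopfStr k H}
    (h : hH.Pt C) (a : hA.Pt C) :
    comul ∘ₗ pair h.lin a.lin = pair (pair h.lin a.lin) (pair h.lin a.lin) :=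
  comul_comp_pair (C := C) h a

theorem counit_comp_lin {hA : HopfStr k A} (a : hA.Pt C) : counit ∘ₗ a.lin = counit :=
  counit_comp (V := A) a

theorem matched_comp_pair [Coalgebra.IsCocomm k C] {hA : HopfStr k A} {hH : HopfStr k H}
    (h : hH.Pt C) (a : hA.Pt C) :
    TensorProduct.map tri quad ∘ₗ comul ∘ₗ pair h.lin a.lin =
      pair (tri ∘ₗ pair h.lin a.lin) (quad ∘ₗ pair h.lin a.lin) := by
  rw [comul_comp_pair_lin, map_comp_pair]

/-- The matched pair of groups formed by the points of a matched pair of Hopf algebras. -/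
noncomputable def IsMatchedPair.points [Coalgebra.IsCocomm k C] [Coalgebra.IsCocomm k A]
    [Coalgebra.IsCocomm k H] {hA : HopfStr k A} {hH : HopfStr k H}
    (P : IsMatchedPair hA hH tri quad) : GroupMatchedPair (hA.Pt C) (hH.Pt C) where
  tri h a := P.tri_coalg.hom.comp (cpair (C := C) h a)
  quad h a := P.quad_coalg.hom.comp (cpair (C := C) h a)
  one_tri a := Pt.lin_injective <| by
    change tri ∘ₗ pair (toSpanSingleton k H hH.one ∘ₗ counit) a.lin = a.lin
    rw [pair_counit_left]
    ext c
    simp [P.tri_module.one_act]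
  mul_tri h g a := Pt.lin_injective <| by
    change tri ∘ₗ pair (hH.mul ∘ₗ pair h.lin g.lin) a.lin =
      tri ∘ₗ pair h.lin (tri ∘ₗ pair g.lin a.lin)
    have e : tri ∘ₗ rTensor A hH.mul = tri ∘ₗ lTensor H tri ∘ₗ
        (TensorProduct.assoc k H H A).toLinearMap := by
      ext x y b
      exact P.tri_module.mul_act x y b
    have := congrArg (· ∘ₗ pair (pair h.lin g.lin) a.lin) e
    simpa only [LinearMap.comp_assoc, rTensor_comp_pair, assoc_comp_pair, lTensor_comp_pair]
      using this
  quad_one h := Pt.lin_injective <| by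
    change quad ∘ₗ pair h.lin (toSpanSingleton k A hA.one ∘ₗ counit) = h.lin
    rw [pair_counit_right]
    ext c
    simp [P.quad_module.act_one]
  quad_mul h a b := Pt.lin_injective <| by
    change quad ∘ₗ pair h.lin (hA.mul ∘ₗ pair a.lin b.lin) =
      quad ∘ₗ pair (quad ∘ₗ pair h.lin a.lin) b.lin
    have e : quad ∘ₗ lTensor H hA.mul = quad ∘ₗ rTensor A quad ∘ₗ
        (TensorProduct.assoc k H A A).symm.toLinearMap := by
      ext x y b
      exact P.quad_module.act_mul x y b
    have := congrArg (· ∘ₗ pair h.lin (pair a.lin b.lin)) e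
    simpa only [LinearMap.comp_assoc, rTensor_comp_pair, assoc_symm_comp_pair, lTensor_comp_pair]
      using this
  tri_one h := Pt.lin_injective <| by
    change tri ∘ₗ pair h.lin (toSpanSingleton k A hA.one ∘ₗ counit) =
      toSpanSingleton k A hA.one ∘ₗ counit
    rw [pair_counit_right, ← counit_comp_lin h]
    ext c
    simp [P.mp1]
  one_quad a := Pt.lin_injective <| by
    change quad ∘ₗ pair (toSpanSingleton k H hH.one ∘ₗ counit) a.lin =
      toSpanSingleton k H hH.one ∘ₗ counit
    rw [pair_counit_left, ← counit_comp_lin a]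
    ext c
    simp [P.mp1']
  tri_mul h a b := Pt.lin_injective <| by
    change tri ∘ₗ pair h.lin (hA.mul ∘ₗ pair a.lin b.lin) =
      hA.mul ∘ₗ pair (tri ∘ₗ pair h.lin a.lin) (tri ∘ₗ pair (quad ∘ₗ pair h.lin a.lin) b.lin)
    have e : tri ∘ₗ lTensor H hA.mul = hA.mul ∘ₗ lTensor A tri ∘ₗ
        (TensorProduct.assoc k A H A).toLinearMap ∘ₗ
        rTensor A (TensorProduct.map tri quad ∘ₗ comul) ∘ₗ
        (TensorProduct.assoc k H A A).symm.toLinearMap := by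
      ext x a b
      exact P.mp2 x a b
    have := congrArg (· ∘ₗ pair h.lin (pair a.lin b.lin)) e
    simpa only [LinearMap.comp_assoc, rTensor_comp_pair, assoc_symm_comp_pair, assoc_comp_pair,
      lTensor_comp_pair, matched_comp_pair] using this
  mul_quad h g a := Pt.lin_injective <| by
    change quad ∘ₗ pair (hH.mul ∘ₗ pair h.lin g.lin) a.lin =
      hH.mul ∘ₗ pair (quad ∘ₗ pair h.lin (tri ∘ₗ pair g.lin a.lin)) (quad ∘ₗ pair g.lin a.lin)
    have e : quad ∘ₗ rTensor A hH.mul = hH.mul ∘ₗ rTensor H quad ∘ₗ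
        (TensorProduct.assoc k H A H).symm.toLinearMap ∘ₗ
        lTensor H (TensorProduct.map tri quad ∘ₗ comul) ∘ₗ
        (TensorProduct.assoc k H H A).toLinearMap := by
      ext x y b
      exact P.mp3 x y b
    have := congrArg (· ∘ₗ pair (pair h.lin g.lin) a.lin) e
    simpa only [LinearMap.comp_assoc, rTensor_comp_pair, assoc_symm_comp_pair, assoc_comp_pair,
      lTensor_comp_pair, matched_comp_pair] using this

theorem ext_pair_left {X Y Z W : Type u} [AddCommGroup X] [Module k X] [Coalgebra k X]
    [AddCommGroup Y] [Module k Y] [Coalgebra k Y] [AddCommGroup Z] [Module k Z] [Coalgebra k Z]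
    [AddCommGroup W] [Module k W]
    [Coalgebra.IsCocomm k X] [Coalgebra.IsCocomm k Y] [Coalgebra.IsCocomm k Z]
    {F G : (X ⊗[k] Y) ⊗[k] Z →ₗ[k] W}
    (h : ∀ (C : Type u) [AddCommGroup C] [Module k C] [Coalgebra k C] [Coalgebra.IsCocomm k C]
      (f : C →ₗc[k] X) (g : C →ₗc[k] Y) (i : C →ₗc[k] Z),
      F ∘ₗ pair (pair (f : C →ₗ[k] X) (g : C →ₗ[k] Y)) (i : C →ₗ[k] Z) =
        G ∘ₗ pair (pair (f : C →ₗ[k] X) (g : C →ₗ[k] Y)) (i : C →ₗ[k] Z)) : F = G := by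
  refine ext_pair fun C _ _ _ _ f g => ?_
  rw [eq_pair_of_comp f]
  exact h C _ _ g

theorem ext_pair_right {X Y Z W : Type u} [AddCommGroup X] [Module k X] [Coalgebra k X]
    [AddCommGroup Y] [Module k Y] [Coalgebra k Y] [AddCommGroup Z] [Module k Z] [Coalgebra k Z]
    [AddCommGroup W] [Module k W]
    [Coalgebra.IsCocomm k X] [Coalgebra.IsCocomm k Y] [Coalgebra.IsCocomm k Z]
    {F G : X ⊗[k] (Y ⊗[k] Z) →ₗ[k] W}
    (h : ∀ (C : Type u) [AddCommGroup C] [Module k C] [Coalgebra k C] [Coalgebra.IsCocomm k C]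
      (f : C →ₗc[k] X) (g : C →ₗc[k] Y) (i : C →ₗc[k] Z),
      F ∘ₗ pair (f : C →ₗ[k] X) (pair (g : C →ₗ[k] Y) (i : C →ₗ[k] Z)) =
        G ∘ₗ pair (f : C →ₗ[k] X) (pair (g : C →ₗ[k] Y) (i : C →ₗ[k] Z))) : F = G := by
  refine ext_pair fun C _ _ _ _ f g => ?_
  rw [eq_pair_of_comp g]
  exact h C f _ _

/-- Morphisms of coalgebras `tri` and `quad` form a matched pair of Hopf algebras as soon as they
induce matched pairs of groups on points. -/
theorem isMatchedPair_of_points [Coalgebra.IsCocomm k A] [Coalgebra.IsCocomm k H]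
    (hA : HopfStr k A) (hH : HopfStr k H) (t : H ⊗[k] A →ₗc[k] A) (q : H ⊗[k] A →ₗc[k] H)
    (P : ∀ (C : Type u) [AddCommGroup C] [Module k C] [Coalgebra k C] [Coalgebra.IsCocomm k C],
      GroupMatchedPair (hA.Pt C) (hH.Pt C))
    (ht : ∀ (C : Type u) [AddCommGroup C] [Module k C] [Coalgebra k C] [Coalgebra.IsCocomm k C]
      (h : hH.Pt C) (a : hA.Pt C), ((P C).tri h a).lin = (t : H ⊗[k] A →ₗ[k] A) ∘ₗ pair h.lin a.lin)
    (hq : ∀ (C : Type u) [AddCommGroup C] [Module k C] [Coalgebra k C] [Coalgebra.IsCocomm k C]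
      (h : hH.Pt C) (a : hA.Pt C),
        ((P C).quad h a).lin = (q : H ⊗[k] A →ₗ[k] H) ∘ₗ pair h.lin a.lin) :
    IsMatchedPair hA hH t q := by
  let iA : hA.Pt A := CoalgHom.id k A
  let iH : hH.Pt H := CoalgHom.id k H
  have hiA : iA.lin = LinearMap.id := rfl
  have hiH : iH.lin = LinearMap.id := rfl
  have e1 := congrArg Pt.lin ((P A).one_tri iA)
  have e1' := congrArg Pt.lin ((P A).one_quad iA)
  have e2 := congrArg Pt.lin ((P H).quad_one iH)
  have e2' := congrArg Pt.lin ((P H).tri_one iH)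
  rw [ht A 1 iA, hiA, Pt.lin_one, pair_counit_left] at e1
  rw [hq A 1 iA, hiA, Pt.lin_one, pair_counit_left] at e1'
  rw [hq H iH 1, hiH, Pt.lin_one, pair_counit_right] at e2
  rw [ht H iH 1, hiH, Pt.lin_one, pair_counit_right] at e2'
  refine
    { tri_module := ⟨fun a => by simpa using LinearMap.congr_fun e1 a, fun x y a => ?_⟩
      tri_coalg := ⟨fun x a => (CoalgHomClass.map_comp_comul_apply t (x ⊗ₜ a)).symm,
        fun x a => (CoalgHomClass.counit_comp_apply t (x ⊗ₜ a)).trans (by simp [mul_comm])⟩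
      quad_module := ⟨fun a => by simpa using LinearMap.congr_fun e2 a, fun x a b => ?_⟩
      quad_coalg := ⟨fun x a => (CoalgHomClass.map_comp_comul_apply q (x ⊗ₜ a)).symm,
        fun x a => (CoalgHomClass.counit_comp_apply q (x ⊗ₜ a)).trans (by simp [mul_comm])⟩
      mp1 := fun x => by simpa using LinearMap.congr_fun e2' x
      mp1' := fun a => by simpa using LinearMap.congr_fun e1' a
      mp2 := fun x a b => ?_
      mp3 := fun x y a => ?_
      mp4 := fun x a => ?_ }
  · have e : (t : H ⊗[k] A →ₗ[k] A) ∘ₗ rTensor A hH.mul = (t : H ⊗[k] A →ₗ[k] A) ∘ₗ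
        lTensor H (t : H ⊗[k] A →ₗ[k] A) ∘ₗ (TensorProduct.assoc k H H A).toLinearMap := by
      refine ext_pair_left fun C _ _ _ _ (h : hH.Pt C) (g : hH.Pt C) (a : hA.Pt C) => ?_
      change _ ∘ₗ pair (pair h.lin g.lin) a.lin = _ ∘ₗ pair (pair h.lin g.lin) a.lin
      have := congrArg Pt.lin ((P C).mul_tri h g a)
      rw [ht C (_ * _) a, Pt.lin_mul, ht C h ((P C).tri g a), ht C g a] at this
      simpa only [LinearMap.comp_assoc, rTensor_comp_pair, assoc_comp_pair, lTensor_comp_pair]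
        using this
    exact LinearMap.congr_fun e ((x ⊗ₜ y) ⊗ₜ a)
  · have e : (q : H ⊗[k] A →ₗ[k] H) ∘ₗ lTensor H hA.mul = (q : H ⊗[k] A →ₗ[k] H) ∘ₗ
        rTensor A (q : H ⊗[k] A →ₗ[k] H) ∘ₗ
        (TensorProduct.assoc k H A A).symm.toLinearMap := by
      refine ext_pair_right fun C _ _ _ _ (h : hH.Pt C) (a : hA.Pt C) (b : hA.Pt C) => ?_
      change _ ∘ₗ pair h.lin (pair a.lin b.lin) = _ ∘ₗ pair h.lin (pair a.lin b.lin)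
      have := congrArg Pt.lin ((P C).quad_mul h a b)
      rw [hq C h (_ * _), Pt.lin_mul, hq C ((P C).quad h a) b, hq C h a] at this
      simpa only [LinearMap.comp_assoc, rTensor_comp_pair, assoc_symm_comp_pair,
        lTensor_comp_pair] using this
    exact LinearMap.congr_fun e (x ⊗ₜ (a ⊗ₜ b))
  · have e : (t : H ⊗[k] A →ₗ[k] A) ∘ₗ lTensor H hA.mul = hA.mul ∘ₗ
        lTensor A (t : H ⊗[k] A →ₗ[k] A) ∘ₗ
        (TensorProduct.assoc k A H A).toLinearMap ∘ₗ
        rTensor A (TensorProduct.map (t : H ⊗[k] A →ₗ[k] A) (q : H ⊗[k] A →ₗ[k] H) ∘ₗ comul) ∘ₗ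
        (TensorProduct.assoc k H A A).symm.toLinearMap := by
      refine ext_pair_right fun C _ _ _ _ (h : hH.Pt C) (a : hA.Pt C) (b : hA.Pt C) => ?_
      change _ ∘ₗ pair h.lin (pair a.lin b.lin) = _ ∘ₗ pair h.lin (pair a.lin b.lin)
      have := congrArg Pt.lin ((P C).tri_mul h a b)
      rw [ht C h (_ * _), Pt.lin_mul, Pt.lin_mul, ht C h a,
        ht C ((P C).quad h a) b, hq C h a] at this
      simpa only [LinearMap.comp_assoc, rTensor_comp_pair, assoc_symm_comp_pair, assoc_comp_pair,
        lTensor_comp_pair, map_comp_pair, comul_comp_pair_lin] using this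
    exact LinearMap.congr_fun e (x ⊗ₜ (a ⊗ₜ b))
  · have e : (q : H ⊗[k] A →ₗ[k] H) ∘ₗ rTensor A hH.mul = hH.mul ∘ₗ
        rTensor H (q : H ⊗[k] A →ₗ[k] H) ∘ₗ
        (TensorProduct.assoc k H A H).symm.toLinearMap ∘ₗ
        lTensor H (TensorProduct.map (t : H ⊗[k] A →ₗ[k] A) (q : H ⊗[k] A →ₗ[k] H) ∘ₗ comul) ∘ₗ
        (TensorProduct.assoc k H H A).toLinearMap := by
      refine ext_pair_left fun C _ _ _ _ (h : hH.Pt C) (g : hH.Pt C) (a : hA.Pt C) => ?_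
      change _ ∘ₗ pair (pair h.lin g.lin) a.lin = _ ∘ₗ pair (pair h.lin g.lin) a.lin
      have := congrArg Pt.lin ((P C).mul_quad h g a)
      rw [hq C (_ * _) a, Pt.lin_mul, Pt.lin_mul, hq C g a,
        hq C h ((P C).tri g a), ht C g a] at this
      simpa only [LinearMap.comp_assoc, rTensor_comp_pair, assoc_symm_comp_pair, assoc_comp_pair,
        lTensor_comp_pair, map_comp_pair, comul_comp_pair_lin] using this
    exact LinearMap.congr_fun e ((x ⊗ₜ y) ⊗ₜ a)
  · have e : pair (q : H ⊗[k] A →ₗ[k] H) (t : H ⊗[k] A →ₗ[k] A) =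
        (TensorProduct.comm k A H).toLinearMap ∘ₗ
          pair (t : H ⊗[k] A →ₗ[k] A) (q : H ⊗[k] A →ₗ[k] H) :=
      (comm_comp_pair _ _).symm
    exact LinearMap.congr_fun e (x ⊗ₜ a)

end

end MatchedPoints

section MatchedBrace

open Coalgebra HopfStr

variable {k}
variable {A H C : Type u}
  [AddCommGroup A] [Module k A] [Coalgebra k A] [Coalgebra.IsCocomm k A]
  [AddCommGroup H] [Module k H] [Coalgebra k H] [Coalgebra.IsCocomm k H]
  [AddCommGroup C] [Module k C] [Coalgebra k C] [Coalgebra.IsCocomm k C]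
  {hA : HopfStr k A} {hH : HopfStr k H}
  {tri : H ⊗[k] A →ₗ[k] A} {quad : H ⊗[k] A →ₗ[k] H}

theorem coalgHom_ext {C V : Type u} [AddCommGroup C] [Module k C] [Coalgebra k C]
    [AddCommGroup V] [Module k V] [Coalgebra k V] {f g : C →ₗc[k] V}
    (h : (f : C →ₗ[k] V) = g) : f = g :=
  CoalgHom.coe_linearMap_injective h

theorem exists_hom {V : Type u} [AddCommGroup V] [Module k V] [Coalgebra k V] (F : V ⊗[k] V →ₗ[k] V)
    (hF : ∀ f g : V ⊗[k] V →ₗc[k] V,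
      ∃ m : V ⊗[k] V →ₗc[k] V, F ∘ₗ pair (f : V ⊗[k] V →ₗ[k] V) g = m) :
    ∃ m : V ⊗[k] V →ₗc[k] V, F = m := by
  obtain ⟨m, hm⟩ := hF (cfst k V V) (csnd k V V)
  rw [pair_cfst_csnd, LinearMap.comp_id] at hm
  exact ⟨m, hm⟩

namespace IsMatchedPair

/-- The point of `A ⊗ H` with given components. -/
noncomputable def pt {P : GroupMatchedPair (hA.Pt C) (hH.Pt C)} (x : P.Bicrossed) :
    C →ₗc[k] A ⊗[k] H :=
  cpair (C := C) x.left x.right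

theorem coe_pt {P : GroupMatchedPair (hA.Pt C) (hH.Pt C)} (x : P.Bicrossed) :
    (pt x : C →ₗ[k] A ⊗[k] H) = pair x.left.lin x.right.lin := rfl

theorem exists_pt (P : GroupMatchedPair (hA.Pt C) (hH.Pt C)) (f : C →ₗc[k] A ⊗[k] H) :
    ∃ x : P.Bicrossed, f = pt x :=
  ⟨⟨(cfst k A H).comp f, (csnd k A H).comp f⟩, coalgHom_ext (eq_pair_of_comp f)⟩

variable (hA hH) in
/-- The bicrossed product multiplication as a linear map. -/
noncomputable def dotLin (tri : H ⊗[k] A →ₗ[k] A) (quad : H ⊗[k] A →ₗ[k] H) :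
    (A ⊗[k] H) ⊗[k] (A ⊗[k] H) →ₗ[k] A ⊗[k] H :=
  sandwich k hA.mul hH.mul ∘ₗ
    rTensor H (lTensor A (TensorProduct.map tri quad ∘ₗ comul) ∘ₗ
      (TensorProduct.assoc k A H A).toLinearMap) ∘ₗ
    (TensorProduct.assoc k (A ⊗[k] H) A H).symm.toLinearMap

variable (hA hH) in
/-- The multiplication `(a ⊗ x) ∘ (b ⊗ y) = ab ⊗ yx` as a linear map. -/
noncomputable def circLin : (A ⊗[k] H) ⊗[k] (A ⊗[k] H) →ₗ[k] A ⊗[k] H :=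
  TensorProduct.map hA.mul (hH.mul ∘ₗ (TensorProduct.comm k H H).toLinearMap) ∘ₗ
    (TensorProduct.tensorTensorTensorComm k A H A H).toLinearMap

variable (P : IsMatchedPair hA hH tri quad)

theorem dotLin_comp_pair (x y : (P.points (C := C)).Bicrossed) :
    dotLin hA hH tri quad ∘ₗ pair (pt x : C →ₗ[k] A ⊗[k] H) (pt y : C →ₗ[k] A ⊗[k] H) =
      pt (x * y) := by
  simp only [coe_pt, dotLin, sandwich, LinearMap.comp_assoc, assoc_symm_comp_pair,
    rTensor_comp_pair, assoc_comp_pair, lTensor_comp_pair, matched_comp_pair, map_comp_pair]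
  rfl

theorem circLin_comp_pair (a b : hA.Pt C) (h g : hH.Pt C) :
    circLin hA hH ∘ₗ pair (pair a.lin h.lin) (pair b.lin g.lin) =
      pair (a * b).lin (g * h).lin := by
  simp only [circLin, LinearMap.comp_assoc, tensorTensorTensorComm_comp_pair, map_comp_pair,
    comm_comp_pair]
  rfl

/-- The bicrossed product Hopf algebra of a matched pair of cocommutative Hopf algebras. -/
theorem exists_dot : ∃ D : HopfStr k (A ⊗[k] H), D.mul = dotLin hA hH tri quad ∧
    ∀ (C : Type u) [AddCommGroup C] [Module k C] [Coalgebra k C] [Coalgebra.IsCocomm k C]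
      (x : (P.points (C := C)).Bicrossed),
      D.antipode ∘ₗ (pt x : C →ₗ[k] A ⊗[k] H) = pt x⁻¹ := by
  obtain ⟨m, hm⟩ := exists_hom (dotLin hA hH tri quad) fun f g => by
    obtain ⟨x, rfl⟩ := exists_pt P.points f
    obtain ⟨y, rfl⟩ := exists_pt P.points g
    exact ⟨_, P.dotLin_comp_pair x y⟩
  have hS (C : Type u) [AddCommGroup C] [Module k C] [Coalgebra k C] [Coalgebra.IsCocomm k C]
      (x : (P.points (C := C)).Bicrossed) :
      (TensorProduct.map tri quad ∘ₗ comul ∘ₗ TensorProduct.map hH.antipode hA.antipode ∘ₗ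
        (TensorProduct.comm k A H).toLinearMap) ∘ₗ (pt x : C →ₗ[k] A ⊗[k] H) = pt x⁻¹ := by
    simp only [coe_pt, LinearMap.comp_assoc, comm_comp_pair, map_comp_pair]
    rw [← Pt.lin_inv, ← Pt.lin_inv, matched_comp_pair]
    rfl
  obtain ⟨S, hS'⟩ : ∃ S : A ⊗[k] H →ₗc[k] A ⊗[k] H,
      TensorProduct.map tri quad ∘ₗ comul ∘ₗ TensorProduct.map hH.antipode hA.antipode ∘ₗ
        (TensorProduct.comm k A H).toLinearMap = S := by
    obtain ⟨x, hx⟩ := exists_pt P.points (CoalgHom.id k (A ⊗[k] H))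
    refine ⟨pt x⁻¹, ?_⟩
    rw [← hS, ← hx]
    rfl
  have hmul {C : Type u} [AddCommGroup C] [Module k C] [Coalgebra k C] [Coalgebra.IsCocomm k C]
      (x y : (P.points (C := C)).Bicrossed) : m.comp (cpair (pt x) (pt y)) = pt (x * y) :=
    coalgHom_ext (by
      rw [CoalgHom.comp_toLinearMap, ← hm]; exact P.dotLin_comp_pair x y)
  have hinv {C : Type u} [AddCommGroup C] [Module k C] [Coalgebra k C] [Coalgebra.IsCocomm k C]
      (x : (P.points (C := C)).Bicrossed) : S.comp (pt x) = pt x⁻¹ :=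
    coalgHom_ext (by
      rw [CoalgHom.comp_toLinearMap, ← hS']; exact hS C x)
  have hone : (cpair hA.cone hH.cone : k →ₗc[k] A ⊗[k] H).comp (counitCoalgHom k (A ⊗[k] H)) =
      pt (1 : (P.points (C := A ⊗[k] H)).Bicrossed) :=
    coalgHom_ext (by
      rw [CoalgHom.comp_toLinearMap, coe_cpair, pair_comp]; rfl)
  refine ⟨HopfStr.ofPoints m (cpair hA.cone hH.cone) S ?_ ?_ ?_ ?_ ?_, hm.symm, ?_⟩
  · intro C _ _ _ _ f g h
    obtain ⟨x, rfl⟩ := exists_pt P.points f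
    obtain ⟨y, rfl⟩ := exists_pt P.points g
    obtain ⟨z, rfl⟩ := exists_pt P.points h
    rw [hmul, hmul, hmul, hmul, _root_.mul_assoc]
  · intro f
    obtain ⟨x, rfl⟩ := exists_pt P.points f
    rw [hone, hmul, _root_.one_mul]
  · intro f
    obtain ⟨x, rfl⟩ := exists_pt P.points f
    rw [hone, hmul, _root_.mul_one]
  · intro f
    obtain ⟨x, rfl⟩ := exists_pt P.points f
    rw [hone, hinv, hmul, inv_mul_cancel]
  · intro f
    obtain ⟨x, rfl⟩ := exists_pt P.points f
    rw [hone, hinv, hmul, mul_inv_cancel]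
  · intro C _ _ _ _ x
    exact congrArg CoalgHom.toLinearMap (hinv x)

/-- The Hopf algebra structure `(a ⊗ x) ∘ (b ⊗ y) = ab ⊗ yx`. -/
theorem exists_circ : ∃ D : HopfStr k (A ⊗[k] H), D.mul = circLin hA hH := by
  obtain ⟨m, hm⟩ := exists_hom (circLin hA hH) fun f g => by
    let a : hA.Pt ((A ⊗[k] H) ⊗[k] (A ⊗[k] H)) := (cfst k A H).comp f
    let b : hA.Pt ((A ⊗[k] H) ⊗[k] (A ⊗[k] H)) := (cfst k A H).comp g
    let x : hH.Pt ((A ⊗[k] H) ⊗[k] (A ⊗[k] H)) := (csnd k A H).comp f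
    let y : hH.Pt ((A ⊗[k] H) ⊗[k] (A ⊗[k] H)) := (csnd k A H).comp g
    have hf : (f : _ →ₗ[k] A ⊗[k] H) = pair a.lin x.lin := eq_pair_of_comp f
    have hg : (g : _ →ₗ[k] A ⊗[k] H) = pair b.lin y.lin := eq_pair_of_comp g
    rw [hf, hg, circLin_comp_pair]
    exact ⟨cpair (C := (A ⊗[k] H) ⊗[k] (A ⊗[k] H)) (a * b) (y * x), rfl⟩
  have hex {C : Type u} [AddCommGroup C] [Module k C] [Coalgebra k C] [Coalgebra.IsCocomm k C]
      (f : C →ₗc[k] A ⊗[k] H) : ∃ (a : hA.Pt C) (h : hH.Pt C), f = cpair (C := C) a h :=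
    ⟨(cfst k A H).comp f, (csnd k A H).comp f, coalgHom_ext (eq_pair_of_comp f)⟩
  have hmul {C : Type u} [AddCommGroup C] [Module k C] [Coalgebra k C] [Coalgebra.IsCocomm k C]
      (a b : hA.Pt C) (h g : hH.Pt C) :
      m.comp (cpair (cpair (C := C) a h) (cpair (C := C) b g)) =
        cpair (C := C) (a * b) (g * h) :=
    coalgHom_ext (by
      rw [CoalgHom.comp_toLinearMap, ← hm]; exact circLin_comp_pair a b h g)
  have hinv {C : Type u} [AddCommGroup C] [Module k C] [Coalgebra k C] [Coalgebra.IsCocomm k C]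
      (a : hA.Pt C) (h : hH.Pt C) :
      (Coalgebra.TensorProduct.map hA.cantipode hH.cantipode).comp (cpair (C := C) a h) =
        cpair (C := C) (a⁻¹ : hA.Pt C) (h⁻¹ : hH.Pt C) :=
    coalgHom_ext (map_comp_pair _ _ _ _)
  have hone : (cpair hA.cone hH.cone : k →ₗc[k] A ⊗[k] H).comp (counitCoalgHom k (A ⊗[k] H)) =
      cpair (C := A ⊗[k] H) (1 : hA.Pt (A ⊗[k] H)) (1 : hH.Pt (A ⊗[k] H)) :=
    coalgHom_ext (by
      rw [CoalgHom.comp_toLinearMap, coe_cpair, pair_comp]; rfl)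
  refine ⟨HopfStr.ofPoints m (cpair hA.cone hH.cone)
    (Coalgebra.TensorProduct.map hA.cantipode hH.cantipode) ?_ ?_ ?_ ?_ ?_, hm.symm⟩
  · intro C _ _ _ _ f g h
    obtain ⟨a, x, rfl⟩ := hex f
    obtain ⟨b, y, rfl⟩ := hex g
    obtain ⟨c, z, rfl⟩ := hex h
    rw [hmul, hmul, hmul, hmul, _root_.mul_assoc, _root_.mul_assoc]
  · intro f
    obtain ⟨a, x, rfl⟩ := hex f
    rw [hone, hmul, _root_.one_mul, _root_.mul_one]
  · intro f
    obtain ⟨a, x, rfl⟩ := hex f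
    rw [hone, hmul, _root_.one_mul, _root_.mul_one]
  · intro f
    obtain ⟨a, x, rfl⟩ := hex f
    rw [hone, hinv, hmul, inv_mul_cancel, mul_inv_cancel]
  · intro f
    obtain ⟨a, x, rfl⟩ := hex f
    rw [hone, hinv, hmul, inv_mul_cancel, mul_inv_cancel]

/-- A matched pair of cocommutative Hopf algebras yields a cocommutative Hopf brace. -/
theorem exists_brace (P : IsMatchedPair hA hH tri quad) : ∃ B : HopfBrace k (A ⊗[k] H),
    (∀ (a b : A) (x y : H), B.dot.mul ((a ⊗ₜ[k] x) ⊗ₜ[k] (b ⊗ₜ[k] y)) =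
      sandwich k hA.mul hH.mul ((a ⊗ₜ[k] matchedEl tri quad x b) ⊗ₜ[k] y)) ∧
    (∀ (a b : A) (x y : H), B.circ.mul ((a ⊗ₜ[k] x) ⊗ₜ[k] (b ⊗ₜ[k] y)) =
      hA.mul (a ⊗ₜ[k] b) ⊗ₜ[k] hH.mul (y ⊗ₜ[k] x)) ∧
    HopfBraceNL.IsCocomm k (A ⊗[k] H) := by
  obtain ⟨D, hD, hS⟩ := P.exists_dot
  obtain ⟨E, hE⟩ := exists_circ (hA := hA) (hH := hH)
  refine ⟨⟨D, E, ?_⟩, fun a b x y => ?_, fun a b x y => ?_, Coalgebra.comm_comp_comul k _⟩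
  · refine ext_pair_right fun C _ _ _ _ f g h => ?_
    obtain ⟨x, rfl⟩ := exists_pt P.points f
    obtain ⟨y, rfl⟩ := exists_pt P.points g
    obtain ⟨z, rfl⟩ := exists_pt P.points h
    have hcirc (x y : (P.points (C := C)).Bicrossed) :
        circLin hA hH ∘ₗ pair (pt x : C →ₗ[k] A ⊗[k] H) (pt y : C →ₗ[k] A ⊗[k] H) =
          pt (⟨x.left * y.left, y.right * x.right⟩ : (P.points (C := C)).Bicrossed) :=
      circLin_comp_pair _ _ _ _
    rw [braceRHS_comp_pair, LinearMap.comp_assoc, lTensor_comp_pair, hD, hE, hS,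
      P.dotLin_comp_pair, hcirc, hcirc, hcirc, P.dotLin_comp_pair, P.dotLin_comp_pair]
    exact congrArg (fun w => (pt w : C →ₗ[k] A ⊗[k] H))
      (P.points.brace x.left y.left z.left x.right y.right z.right)
  · rw [hD]
    rfl
  · rw [hE]
    rfl

end IsMatchedPair

end MatchedBrace

section Enveloping

open Coalgebra

variable {k}

/-- `ι : L → A` exhibits the bialgebra `A` as an enveloping algebra of `L` with primitive
generators. -/
structure IsEnveloping {L A : Type u} [LieRing L] [LieAlgebra k L] [Ring A] [Bialgebra k A]
    (ι : L →ₗ[k] A) : Prop where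
  map_lie : ∀ a b, ι ⁅a, b⁆ = ι a * ι b - ι b * ι a
  exists_lift : ∀ {B : Type u} [Ring B] [Algebra k B] (f : L →ₗ[k] B),
    (∀ a b, f ⁅a, b⁆ = f a * f b - f b * f a) → ∃ F : A →ₐ[k] B, ∀ a, F (ι a) = f a
  eq_top : ∀ N : Submodule k A, 1 ∈ N → (∀ a, ∀ u ∈ N, ι a * u ∈ N) → N = ⊤
  comul_ι : ∀ a, comul (R := k) (ι a) = ι a ⊗ₜ[k] 1 + 1 ⊗ₜ[k] ι a
  counit_ι : ∀ a, counit (R := k) (ι a) = 0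

namespace IsEnveloping

variable {L A V : Type u} [LieRing L] [LieAlgebra k L] [Ring A] [Bialgebra k A]
  [AddCommGroup V] [Module k V] {ι : L →ₗ[k] A}

theorem induction (hι : IsEnveloping ι) {p : A → Prop} (one : p 1)
    (add : ∀ u v, p u → p v → p (u + v)) (smul : ∀ (c : k) u, p u → p (c • u))
    (mul : ∀ a u, p u → p (ι a * u)) (u : A) : p u := by
  let N : Submodule k A :=
    { carrier := {u | p u}
      add_mem' := fun hu hv => add _ _ hu hv
      zero_mem' := by simpa using smul 0 1 one
      smul_mem' := fun c _ hu => smul c _ hu }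
  have h : N = ⊤ := hι.eq_top N one mul
  exact (h ▸ Submodule.mem_top : u ∈ N)

theorem linearMap_ext (hι : IsEnveloping ι) {F G : A →ₗ[k] V} (one : F 1 = G 1)
    (mul : ∀ a u, F u = G u → F (ι a * u) = G (ι a * u)) : F = G :=
  LinearMap.ext <| hι.induction one (fun u v hu hv => by rw [map_add, map_add, hu, hv])
    (fun c u hu => by rw [map_smul, map_smul, hu]) mul

theorem isCocomm (hι : IsEnveloping ι) : Coalgebra.IsCocomm k A where
  comm_comp_comul := by
    refine hι.linearMap_ext (by simp [Algebra.TensorProduct.one_def]) fun a u hu => ?_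
    have h (v w : A ⊗[k] A) : TensorProduct.comm k A A (v * w) =
        TensorProduct.comm k A A v * TensorProduct.comm k A A w :=
      map_mul (Algebra.TensorProduct.comm k A A) v w
    simp only [LinearMap.comp_apply, LinearEquiv.coe_coe] at hu ⊢
    rw [Bialgebra.comul_mul, h, hu, hι.comul_ι]
    simp [add_comm]

end IsEnveloping

end Enveloping

section LieExtension

open Coalgebra

variable {k}
variable {L L' A H : Type u} [LieRing L] [LieAlgebra k L] [LieRing L'] [LieAlgebra k L']
  [Ring A] [Bialgebra k A] [Ring H] [Bialgebra k H]
  {ι : L →ₗ[k] A} {ι' : L' →ₗ[k] H}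
  {tri0 : L' →ₗ[k] L →ₗ[k] L} {quad0 : L' →ₗ[k] L →ₗ[k] L'}

theorem exists_extension_data (hι : IsEnveloping ι)
    (hquad0 : ∀ (x : L') (a b : L),
      quad0 x ⁅a, b⁆ = quad0 (quad0 x a) b - quad0 (quad0 x b) a)
    (hmp1 : ∀ (x : L') (a b : L),
      tri0 x ⁅a, b⁆ =
        ⁅tri0 x a, b⁆ + ⁅a, tri0 x b⁆ + tri0 (quad0 x a) b - tri0 (quad0 x b) a) :
    ∃ F : A →ₗ[k] L' →ₗ[k] A ⊗[k] H, (∀ x, F 1 x = 1 ⊗ₜ ι' x) ∧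
      ∀ a b x, F (ι a * b) x = (ι (tri0 x a) * b) ⊗ₜ 1 + (ι a ⊗ₜ 1) * F b x + F b (quad0 x a) := by
  let φ₀ (a : L) : A × (L' →ₗ[k] A ⊗[k] H) →ₗ[k] L' →ₗ[k] A ⊗[k] H :=
    { toFun := fun p =>
        (TensorProduct.mk k A H).flip 1 ∘ₗ LinearMap.mulRight k p.1 ∘ₗ ι ∘ₗ tri0.flip a +
          LinearMap.mulLeft k (ι a ⊗ₜ 1) ∘ₗ p.2 + p.2 ∘ₗ quad0.flip a
      map_add' := fun p q => by
        ext x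
        simp [mul_add]
        abel
      map_smul' := fun c p => by
        ext x
        simp [TensorProduct.smul_tmul'] }
  let φ : L →ₗ[k] Module.End k (A × (L' →ₗ[k] A ⊗[k] H)) :=
    { toFun := fun a => (LinearMap.mulLeft k (ι a) ∘ₗ LinearMap.fst k _ _).prod (φ₀ a)
      map_add' := fun a b => by
        refine LinearMap.ext fun p => Prod.ext (by simp [add_mul]) (LinearMap.ext fun x => ?_)
        simp [φ₀, add_mul, TensorProduct.add_tmul]
        abel
      map_smul' := fun c a => by
        refine LinearMap.ext fun p => Prod.ext (by simp) (LinearMap.ext fun x => ?_)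
        simp [φ₀, ← TensorProduct.smul_tmul'] }
  have hφ₁ (a : L) (p) : (φ a p).1 = ι a * p.1 := rfl
  have hφ₂ (a : L) (p) (x : L') : (φ a p).2 x =
      (ι (tri0 x a) * p.1) ⊗ₜ 1 + (ι a ⊗ₜ 1) * p.2 x + p.2 (quad0 x a) := rfl
  obtain ⟨Φ, hΦ⟩ := hι.exists_lift (B := Module.End k (A × (L' →ₗ[k] A ⊗[k] H))) φ fun a b => by
    refine LinearMap.ext fun p => Prod.ext ?_ (LinearMap.ext fun x => ?_)
    · simp only [LinearMap.sub_apply, Module.End.mul_apply, Prod.fst_sub, hφ₁, hι.map_lie]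
      noncomm_ring
    · simp only [LinearMap.sub_apply, Module.End.mul_apply, Prod.snd_sub, hφ₂, hφ₁, hι.map_lie,
        hmp1, hquad0, map_add, map_sub, mul_add, add_mul, sub_mul, TensorProduct.add_tmul,
        TensorProduct.sub_tmul, ← mul_assoc, Algebra.TensorProduct.tmul_mul_tmul, one_mul]
      abel
  let p₀ : A × (L' →ₗ[k] A ⊗[k] H) := (1, TensorProduct.mk k A H 1 ∘ₗ ι')
  have h₁ (b : A) : (Φ b p₀).1 = b := by
    refine hι.induction (p := fun b => (Φ b p₀).1 = b) ?_ ?_ ?_ ?_ b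
    · simp [p₀]
    · intro u v hu hv
      simp [hu, hv]
    · intro c u hu
      simp [hu]
    · intro a u hu
      simp [hΦ, hφ₁, hu]
  refine ⟨LinearMap.snd k _ _ ∘ₗ LinearMap.applyₗ p₀ ∘ₗ Φ.toLinearMap, fun x => ?_,
    fun a b x => ?_⟩
  · simp [p₀]
  · simp [hΦ, hφ₂, h₁]

theorem exists_extension_hom (hι : IsEnveloping ι) (hι' : IsEnveloping ι')
    (htri0 : ∀ (x y : L') (a : L),
      tri0 ⁅x, y⁆ a = tri0 x (tri0 y a) - tri0 y (tri0 x a))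
    (hquad0 : ∀ (x : L') (a b : L),
      quad0 x ⁅a, b⁆ = quad0 (quad0 x a) b - quad0 (quad0 x b) a)
    (hmp1 : ∀ (x : L') (a b : L),
      tri0 x ⁅a, b⁆ =
        ⁅tri0 x a, b⁆ + ⁅a, tri0 x b⁆ + tri0 (quad0 x a) b - tri0 (quad0 x b) a)
    (hmp2 : ∀ (x y : L') (a : L),
      quad0 ⁅x, y⁆ a =
        ⁅quad0 x a, y⁆ + ⁅x, quad0 y a⁆ + quad0 x (tri0 y a) - quad0 y (tri0 x a)) :
    ∃ R : H →ₐ[k] Module.End k (A ⊗[k] H),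
      (∀ h m y, R h (m * 1 ⊗ₜ y) = R h m * 1 ⊗ₜ y) ∧ (∀ h, R h 1 = 1 ⊗ₜ h) ∧
      ∀ x a m, R (ι' x) (ι a ⊗ₜ 1 * m) =
        ι a ⊗ₜ 1 * R (ι' x) m + ι (tri0 x a) ⊗ₜ 1 * m + R (ι' (quad0 x a)) m := by
  obtain ⟨F, hF1, hF⟩ := exists_extension_data (H := H) (ι' := ι') hι hquad0 hmp1
  let X : L' →ₗ[k] Module.End k (A ⊗[k] H) :=
    { toFun := fun x => LinearMap.mul' k (A ⊗[k] H) ∘ₗ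
        TensorProduct.map (F.flip x) (TensorProduct.mk k A H 1)
      map_add' := fun x y => by ext; simp [add_mul]
      map_smul' := fun c x => by ext; simp }
  have hX (x : L') (b : A) (y : H) : X x (b ⊗ₜ y) = F b x * 1 ⊗ₜ y := rfl
  have hXF (x : L') (b : A) : X x (b ⊗ₜ 1) = F b x := by
    rw [hX, ← Algebra.TensorProduct.one_def, mul_one]
  have hXR (x : L') (m : A ⊗[k] H) (y : H) : X x (m * 1 ⊗ₜ y) = X x m * 1 ⊗ₜ y := by
    induction m with
    | zero => simp
    | add u v hu hv => simp only [add_mul, map_add, hu, hv]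
    | tmul b z => simp [hX, mul_assoc]
  have hXC (x : L') (a : L) (m : A ⊗[k] H) : X x (ι a ⊗ₜ 1 * m) =
      ι a ⊗ₜ 1 * X x m + ι (tri0 x a) ⊗ₜ 1 * m + X (quad0 x a) m := by
    induction m with
    | zero => simp
    | add u v hu hv =>
      simp only [mul_add, map_add, hu, hv]
      abel
    | tmul b z =>
      rw [Algebra.TensorProduct.tmul_mul_tmul, hX, hF]
      simp [hX, add_mul, mul_assoc]
      abel
  have hXX (x y : L') (b : A) : F b ⁅x, y⁆ = X x (F b y) - X y (F b x) := by
    refine hι.induction (p := fun b => ∀ x y, F b ⁅x, y⁆ = X x (F b y) - X y (F b x))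
      ?_ ?_ ?_ ?_ b x y
    · intro x y
      simp only [hF1, hX, hι'.map_lie, TensorProduct.tmul_sub,
        Algebra.TensorProduct.tmul_mul_tmul, one_mul]
    · intro u v hu hv x y
      simp only [map_add, LinearMap.add_apply, hu, hv]
      abel
    · intro c u hu x y
      simp only [map_smul, LinearMap.smul_apply, hu, smul_sub]
    · intro a b hb x y
      simp only [hF, map_add, hXC, hXF, hb, hmp2, htri0, map_sub, mul_sub, sub_mul,
        TensorProduct.sub_tmul]
      abel
  obtain ⟨R, hR⟩ := hι'.exists_lift (B := Module.End k (A ⊗[k] H)) X fun x y => by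
    refine TensorProduct.ext' fun b z => ?_
    have h : (b ⊗ₜ[k] z : A ⊗[k] H) = b ⊗ₜ 1 * 1 ⊗ₜ z := by simp
    change X ⁅x, y⁆ (b ⊗ₜ z) = X x (X y (b ⊗ₜ z)) - X y (X x (b ⊗ₜ z))
    rw [h, hXR, hXR, hXR, hXR, hXR, hXF, hXF, hXF, hXX, sub_mul]
  have hRR (h : H) : ∀ m y, R h (m * 1 ⊗ₜ y) = R h m * 1 ⊗ₜ y := by
    refine hι'.induction (p := fun h => ∀ m y, R h (m * 1 ⊗ₜ y) = R h m * 1 ⊗ₜ y)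
      ?_ ?_ ?_ ?_ h
    · simp
    · intro u v hu hv m y
      simp only [map_add, LinearMap.add_apply, hu, hv, add_mul]
    · intro c u hu m y
      simp only [map_smul, LinearMap.smul_apply, hu, smul_mul_assoc]
    · intro x u hu m y
      simp only [map_mul, Module.End.mul_apply, hR, hu, hXR]
  refine ⟨R, hRR, fun h => ?_, fun x a m => by simp only [hR, hXC]⟩
  refine hι'.induction (p := fun h => R h 1 = 1 ⊗ₜ h) ?_ ?_ ?_ ?_ h
  · simp [Algebra.TensorProduct.one_def]
  · intro u v hu hv
    simp [hu, hv, TensorProduct.tmul_add]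
  · intro c u hu
    simp [hu]
  · intro x u hu
    have h1 : X x 1 = 1 ⊗ₜ ι' x := by
      rw [Algebra.TensorProduct.one_def, hXF, hF1]
    have h2 := hXR x 1 u
    rw [one_mul, h1] at h2
    simp [hR, hu, h2]

end LieExtension

section ExtensionHom

open Coalgebra

variable {k}
variable {L L' A H : Type u} [LieRing L] [LieAlgebra k L] [LieRing L'] [LieAlgebra k L']
  [Ring A] [Bialgebra k A] [Ring H] [Bialgebra k H]
  {ι : L →ₗ[k] A} {ι' : L' →ₗ[k] H}
  {tri0 : L' →ₗ[k] L →ₗ[k] L} {quad0 : L' →ₗ[k] L →ₗ[k] L'}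

/-- `R` describes left multiplication by `H` on the bicrossed product `A ⊗ H` extending the
given actions of Lie algebras. -/
structure IsExtensionHom (ι : L →ₗ[k] A) (ι' : L' →ₗ[k] H)
    (tri0 : L' →ₗ[k] L →ₗ[k] L) (quad0 : L' →ₗ[k] L →ₗ[k] L')
    (R : H →ₐ[k] Module.End k (A ⊗[k] H)) : Prop where
  apply_mul : ∀ h m y, R h (m * 1 ⊗ₜ y) = R h m * 1 ⊗ₜ y
  apply_one : ∀ h, R h 1 = 1 ⊗ₜ h
  apply_gen_mul : ∀ x a m, R (ι' x) (ι a ⊗ₜ 1 * m) =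
    ι a ⊗ₜ 1 * R (ι' x) m + ι (tri0 x a) ⊗ₜ 1 * m + R (ι' (quad0 x a)) m

namespace IsExtensionHom

variable {R : H →ₐ[k] Module.End k (A ⊗[k] H)}

variable (k A H) in
/-- Left multiplication by `a ⊗ 1` on `A ⊗ H`. -/
noncomputable def leftMul : A →ₐ[k] Module.End k (A ⊗[k] H) :=
  (Algebra.lmul k (A ⊗[k] H)).comp Algebra.TensorProduct.includeLeft

theorem leftMul_apply (a : A) (m : A ⊗[k] H) : leftMul k A H a m = a ⊗ₜ 1 * m := rfl

/-- The operator on `A ⊗ H` attached to an element: `a ⊗ y ↦ (a ⊗ 1) R(y)`. -/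
noncomputable def operator (R : H →ₐ[k] Module.End k (A ⊗[k] H)) :
    A ⊗[k] H →ₗ[k] Module.End k (A ⊗[k] H) :=
  LinearMap.mul' k (Module.End k (A ⊗[k] H)) ∘ₗ
    TensorProduct.map (leftMul k A H).toLinearMap R.toLinearMap

theorem operator_tmul (a : A) (y : H) : operator R (a ⊗ₜ y) = leftMul k A H a * R y := rfl

theorem operator_mul_tmul (m : A ⊗[k] H) (y : H) :
    operator R (m * 1 ⊗ₜ y) = operator R m * R y := by
  induction m with
  | zero => simp
  | add u v hu hv => simp only [add_mul, map_add, hu, hv]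
  | tmul b z =>
    rw [Algebra.TensorProduct.tmul_mul_tmul, mul_one, operator_tmul, operator_tmul, map_mul,
      mul_assoc]

theorem operator_tmul_mul (a : A) (m : A ⊗[k] H) :
    operator R (a ⊗ₜ 1 * m) = leftMul k A H a * operator R m := by
  induction m with
  | zero => simp
  | add u v hu hv => simp only [mul_add, map_add, hu, hv]
  | tmul b z =>
    rw [Algebra.TensorProduct.tmul_mul_tmul, one_mul, operator_tmul, operator_tmul, map_mul,
      mul_assoc]

theorem tmul_eq (b : A) (y : H) : (b ⊗ₜ[k] y : A ⊗[k] H) = b ⊗ₜ 1 * 1 ⊗ₜ y := by simp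

theorem gen_mul_leftMul (hR : IsExtensionHom ι ι' tri0 quad0 R) (x : L') (a : L) :
    R (ι' x) * leftMul k A H (ι a) = leftMul k A H (ι a) * R (ι' x) +
      leftMul k A H (ι (tri0 x a)) + R (ι' (quad0 x a)) :=
  LinearMap.ext (hR.apply_gen_mul x a)

theorem gen_mul_operator (hι : IsEnveloping ι) (hR : IsExtensionHom ι ι' tri0 quad0 R)
    (x : L') (m : A ⊗[k] H) : R (ι' x) * operator R m = operator R (R (ι' x) m) := by
  have key (b : A) : ∀ x, R (ι' x) * leftMul k A H b = operator R (R (ι' x) (b ⊗ₜ 1)) := by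
    refine hι.induction
      (p := fun b => ∀ x, R (ι' x) * leftMul k A H b = operator R (R (ι' x) (b ⊗ₜ 1)))
      ?_ ?_ ?_ ?_ b
    · intro x
      rw [← Algebra.TensorProduct.one_def, hR.apply_one, operator_tmul, map_one, mul_one, one_mul]
    · intro u v hu hv x
      simp only [map_add, mul_add, TensorProduct.add_tmul, hu, hv]
    · intro c u hu x
      simp only [map_smul, mul_smul_comm, ← TensorProduct.smul_tmul', hu]
    · intro a u hu x
      have h : ((ι a * u) ⊗ₜ[k] 1 : A ⊗[k] H) = ι a ⊗ₜ 1 * u ⊗ₜ 1 := by simp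
      rw [h, hR.apply_gen_mul, map_add, map_add, operator_tmul_mul, operator_tmul_mul, ← hu, ← hu,
        operator_tmul, map_one, mul_one, map_mul, ← mul_assoc, hR.gen_mul_leftMul]
      simp only [add_mul, mul_assoc]
  induction m with
  | zero => simp
  | add u v hu hv => simp only [mul_add, map_add, hu, hv]
  | tmul b y =>
    rw [tmul_eq, hR.apply_mul, operator_mul_tmul, operator_mul_tmul, ← key, operator_tmul, map_one,
      mul_one, mul_assoc]

theorem mul_leftMul (hι : IsEnveloping ι) (hι' : IsEnveloping ι')
    (hR : IsExtensionHom ι ι' tri0 quad0 R) (h : H) (b : A) :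
    R h * leftMul k A H b = operator R (R h (b ⊗ₜ 1)) := by
  refine hι'.induction (p := fun h => R h * leftMul k A H b = operator R (R h (b ⊗ₜ 1)))
    ?_ ?_ ?_ ?_ h
  · simp [operator_tmul]
  · intro u v hu hv
    simp only [map_add, add_mul, LinearMap.add_apply, hu, hv]
  · intro c u hu
    simp only [map_smul, smul_mul_assoc, LinearMap.smul_apply, hu]
  · intro x u hu
    rw [map_mul, mul_assoc, hu, hR.gen_mul_operator hι, Module.End.mul_apply]

/-! ### Compatibility with the coalgebra structures -/

theorem comul_tmul_one (b : A) : comul (R := k) (b ⊗ₜ[k] 1 : A ⊗[k] H) =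
    TensorProduct.map ((TensorProduct.mk k A H).flip 1) ((TensorProduct.mk k A H).flip 1)
      (comul (R := k) b) := by
  rw [TensorProduct.comul_tmul, Bialgebra.comul_one]
  generalize comul (R := k) b = P
  induction P with
  | zero => simp
  | add u v hu hv => simp only [TensorProduct.add_tmul, map_add, hu, hv]
  | tmul p q => simp [Algebra.TensorProduct.one_def]

theorem comul_one_tmul (y : H) : comul (R := k) (1 ⊗ₜ[k] y : A ⊗[k] H) =
    TensorProduct.map (TensorProduct.mk k A H 1) (TensorProduct.mk k A H 1)
      (comul (R := k) y) := by
  rw [TensorProduct.comul_tmul, Bialgebra.comul_one]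
  generalize comul (R := k) y = P
  induction P with
  | zero => simp
  | add u v hu hv => simp only [TensorProduct.tmul_add, map_add, hu, hv]
  | tmul p q => simp [Algebra.TensorProduct.one_def]

/-- The coproduct `f ⊗ 1 + 1 ⊗ f` of a primitive operator. -/
noncomputable def primitive {M : Type u} [AddCommGroup M] [Module k M] (f : Module.End k M) :
    Module.End k (M ⊗[k] M) :=
  TensorProduct.map f 1 + TensorProduct.map 1 f

theorem primitive_tmul {M : Type u} [AddCommGroup M] [Module k M] (f : Module.End k M)
    (p q : M) : primitive f (p ⊗ₜ[k] q) = f p ⊗ₜ q + p ⊗ₜ f q := rfl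

theorem primitive_mul (hR : IsExtensionHom ι ι' tri0 quad0 R) (h : H)
    (P : (A ⊗[k] H) ⊗[k] (A ⊗[k] H)) (Q : H ⊗[k] H) :
    primitive (R h)
        (P * TensorProduct.map (TensorProduct.mk k A H 1) (TensorProduct.mk k A H 1) Q) =
      primitive (R h) P *
        TensorProduct.map (TensorProduct.mk k A H 1) (TensorProduct.mk k A H 1) Q := by
  induction P with
  | zero => simp
  | add u v hu hv => simp only [map_add, add_mul, hu, hv]
  | tmul p q =>
    induction Q with
    | zero => simp
    | add u v hu hv => simp only [map_add, mul_add, hu, hv]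
    | tmul y z =>
      simp only [TensorProduct.map_tmul, TensorProduct.mk_apply,
        Algebra.TensorProduct.tmul_mul_tmul, primitive_tmul, hR.apply_mul, add_mul]

theorem primitive_gen_mul (hR : IsExtensionHom ι ι' tri0 quad0 R) (x : L') (a : L)
    (P : (A ⊗[k] H) ⊗[k] (A ⊗[k] H)) :
    primitive (R (ι' x)) (((ι a ⊗ₜ 1) ⊗ₜ 1 + 1 ⊗ₜ (ι a ⊗ₜ 1)) * P) =
      ((ι a ⊗ₜ 1) ⊗ₜ 1 + 1 ⊗ₜ (ι a ⊗ₜ 1)) * primitive (R (ι' x)) P +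
        ((ι (tri0 x a) ⊗ₜ 1) ⊗ₜ 1 + 1 ⊗ₜ (ι (tri0 x a) ⊗ₜ 1)) * P +
        primitive (R (ι' (quad0 x a))) P := by
  induction P with
  | zero => simp
  | add u v hu hv =>
    simp only [map_add, mul_add, hu, hv]
    abel
  | tmul p q =>
    simp only [add_mul, Algebra.TensorProduct.tmul_mul_tmul, map_add, primitive_tmul, one_mul,
      hR.apply_gen_mul, TensorProduct.add_tmul, TensorProduct.tmul_add, mul_add]
    abel

theorem comul_gen_tmul_one (hι : IsEnveloping ι) (a : L) :
    comul (R := k) (ι a ⊗ₜ[k] 1 : A ⊗[k] H) = (ι a ⊗ₜ 1) ⊗ₜ 1 + 1 ⊗ₜ (ι a ⊗ₜ 1) := by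
  rw [comul_tmul_one, hι.comul_ι]
  simp [Algebra.TensorProduct.one_def]

theorem comul_gen_apply (hι : IsEnveloping ι) (hι' : IsEnveloping ι')
    (hR : IsExtensionHom ι ι' tri0 quad0 R) (x : L') (m : A ⊗[k] H) :
    comul (R := k) (R (ι' x) m) = primitive (R (ι' x)) (comul (R := k) m) := by
  have key (b : A) : ∀ x, comul (R := k) (R (ι' x) (b ⊗ₜ 1)) =
      primitive (R (ι' x)) (comul (R := k) (b ⊗ₜ[k] 1 : A ⊗[k] H)) := by
    refine hι.induction (p := fun b => ∀ x, comul (R := k) (R (ι' x) (b ⊗ₜ 1)) =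
      primitive (R (ι' x)) (comul (R := k) (b ⊗ₜ[k] 1 : A ⊗[k] H))) ?_ ?_ ?_ ?_ b
    · intro x
      rw [← Algebra.TensorProduct.one_def, hR.apply_one, comul_one_tmul, hι'.comul_ι,
        Bialgebra.comul_one, Algebra.TensorProduct.one_def, primitive_tmul, hR.apply_one]
      simp [Algebra.TensorProduct.one_def]
    · intro u v hu hv x
      simp only [map_add, TensorProduct.add_tmul, hu, hv]
    · intro c u hu x
      simp only [map_smul, ← TensorProduct.smul_tmul', hu]
    · intro a u hu x
      have h : ((ι a * u) ⊗ₜ[k] 1 : A ⊗[k] H) = ι a ⊗ₜ 1 * u ⊗ₜ 1 := by simp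
      rw [h, hR.apply_gen_mul, map_add, map_add]
      simp only [Bialgebra.comul_mul, comul_gen_tmul_one hι, hu, hR.primitive_gen_mul]
  induction m with
  | zero => simp
  | add u v hu hv => simp only [map_add, hu, hv]
  | tmul b y =>
    rw [tmul_eq, hR.apply_mul, Bialgebra.comul_mul, Bialgebra.comul_mul, key, comul_one_tmul,
      hR.primitive_mul]

theorem counit_gen_apply (hι : IsEnveloping ι) (hι' : IsEnveloping ι')
    (hR : IsExtensionHom ι ι' tri0 quad0 R) (x : L') (m : A ⊗[k] H) :
    counit (R := k) (R (ι' x) m) = 0 := by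
  have key (b : A) : ∀ x, counit (R := k) (R (ι' x) (b ⊗ₜ 1)) = 0 := by
    refine hι.induction (p := fun b => ∀ x, counit (R := k) (R (ι' x) (b ⊗ₜ 1)) = 0)
      ?_ ?_ ?_ ?_ b
    · intro x
      rw [← Algebra.TensorProduct.one_def, hR.apply_one, TensorProduct.counit_tmul, hι'.counit_ι]
      simp
    · intro u v hu hv x
      simp only [map_add, TensorProduct.add_tmul, hu, hv, add_zero]
    · intro c u hu x
      simp only [map_smul, ← TensorProduct.smul_tmul', hu, smul_zero]
    · intro a u hu x
      have h : ((ι a * u) ⊗ₜ[k] 1 : A ⊗[k] H) = ι a ⊗ₜ 1 * u ⊗ₜ 1 := by simp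
      rw [h, hR.apply_gen_mul, map_add, map_add, Bialgebra.counit_mul, Bialgebra.counit_mul, hu,
        hu, TensorProduct.counit_tmul, hι.counit_ι, TensorProduct.counit_tmul, hι.counit_ι]
      simp
  induction m with
  | zero => simp
  | add u v hu hv => simp only [map_add, hu, hv, add_zero]
  | tmul b y => rw [tmul_eq, hR.apply_mul, Bialgebra.counit_mul, key, zero_mul]

/-- The operator `R(h₁) ⊗ R(h₂)` attached to `h₁ ⊗ h₂`. -/
noncomputable def doubled (R : H →ₐ[k] Module.End k (A ⊗[k] H)) :
    H ⊗[k] H →ₗ[k] Module.End k ((A ⊗[k] H) ⊗[k] (A ⊗[k] H)) :=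
  TensorProduct.homTensorHomMap (.id k) _ _ _ _ ∘ₗ TensorProduct.map R.toLinearMap R.toLinearMap

theorem doubled_tmul (g h : H) : doubled R (g ⊗ₜ h) = TensorProduct.map (R g) (R h) := rfl

theorem doubled_gen_mul (h : H) (Q : H ⊗[k] H) :
    doubled R ((h ⊗ₜ 1 + 1 ⊗ₜ h) * Q) = primitive (R h) * doubled R Q := by
  induction Q with
  | zero => simp
  | add u v hu hv => simp only [map_add, mul_add, hu, hv]
  | tmul p q =>
    refine TensorProduct.ext' fun m n => ?_
    simp [add_mul, doubled_tmul, primitive_tmul]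

theorem comul_apply (hι : IsEnveloping ι) (hι' : IsEnveloping ι')
    (hR : IsExtensionHom ι ι' tri0 quad0 R) (h : H) (m : A ⊗[k] H) :
    comul (R := k) (R h m) = doubled R (comul (R := k) h) (comul (R := k) m) := by
  refine hι'.induction (p := fun h =>
    comul (R := k) (R h m) = doubled R (comul (R := k) h) (comul (R := k) m)) ?_ ?_ ?_ ?_ h
  · rw [Bialgebra.comul_one, Algebra.TensorProduct.one_def, doubled_tmul]
    simp
  · intro u v hu hv
    simp only [map_add, LinearMap.add_apply, hu, hv]
  · intro c u hu
    simp only [map_smul, LinearMap.smul_apply, hu]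
  · intro x u hu
    rw [map_mul, Module.End.mul_apply, hR.comul_gen_apply hι hι', hu, Bialgebra.comul_mul,
      hι'.comul_ι, doubled_gen_mul, Module.End.mul_apply]

theorem counit_apply (hι : IsEnveloping ι) (hι' : IsEnveloping ι')
    (hR : IsExtensionHom ι ι' tri0 quad0 R) (h : H) (m : A ⊗[k] H) :
    counit (R := k) (R h m) = counit (R := k) h * counit (R := k) m := by
  refine hι'.induction (p := fun h =>
    counit (R := k) (R h m) = counit (R := k) h * counit (R := k) m) ?_ ?_ ?_ ?_ h
  · simp
  · intro u v hu hv
    simp only [map_add, LinearMap.add_apply, hu, hv, add_mul]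
  · intro c u hu
    simp only [map_smul, LinearMap.smul_apply, hu, smul_mul_assoc]
  · intro x u hu
    rw [map_mul, Module.End.mul_apply, hR.counit_gen_apply hι hι', Bialgebra.counit_mul,
      hι'.counit_ι, zero_mul, zero_mul]

/-- The map `h ⊗ a ↦ R(h)(a ⊗ 1)` as a morphism of coalgebras. -/
noncomputable def crossing (hι : IsEnveloping ι) (hι' : IsEnveloping ι')
    (hR : IsExtensionHom ι ι' tri0 quad0 R) : H ⊗[k] A →ₗc[k] A ⊗[k] H where
  __ := TensorProduct.lift R.toLinearMap ∘ₗ lTensor H ((TensorProduct.mk k A H).flip 1)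
  counit_comp := TensorProduct.ext' fun h a => by
    simp [hR.counit_apply hι hι', TensorProduct.counit_tmul, mul_comm]
  map_comp_comul := TensorProduct.ext' fun h a => by
    simp only [LinearMap.comp_apply, lTensor_tmul, LinearMap.flip_apply, TensorProduct.mk_apply,
      TensorProduct.lift.tmul, AlgHom.toLinearMap_apply]
    rw [hR.comul_apply hι hι', comul_tmul_one, TensorProduct.comul_tmul]
    generalize comul (R := k) h = P
    generalize comul (R := k) a = Q
    induction P with
    | zero => simp
    | add u v hu hv => simp only [TensorProduct.add_tmul, map_add, LinearMap.add_apply, hu, hv]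
    | tmul p q =>
      induction Q with
      | zero => simp
      | add u v hu hv => simp only [TensorProduct.tmul_add, map_add, hu, hv]
      | tmul b c => simp [doubled_tmul]

theorem crossing_tmul (hι : IsEnveloping ι) (hι' : IsEnveloping ι')
    (hR : IsExtensionHom ι ι' tri0 quad0 R) (h : H) (a : A) :
    hR.crossing hι hι' (h ⊗ₜ a) = R h (a ⊗ₜ 1) := rfl

end IsExtensionHom

end ExtensionHom

section MatchedPairExistence

open Coalgebra HopfStr WithConv

variable {k}

/-- An algebra morphism induces a morphism from points to the convolution algebra. -/
noncomputable def pointHom {V E C : Type u} [Ring V] [Bialgebra k V] [Coalgebra.IsCocomm k V]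
    [Ring E] [Algebra k E] [AddCommGroup C] [Module k C] [Coalgebra k C] [Coalgebra.IsCocomm k C]
    {hs : HopfStr k V} (hmul : hs.mul = LinearMap.mul' k V) (hone : hs.one = 1) (Φ : V →ₐ[k] E) :
    hs.Pt C →* WithConv (C →ₗ[k] E) where
  toFun f := toConv (Φ.toLinearMap ∘ₗ f.lin)
  map_one' := by
    rw [Pt.lin_one, hone, LinearMap.convOne_def]
    congr 1
    ext c
    simp [Algebra.algebraMap_eq_smul_one]
  map_mul' f g := by
    rw [Pt.lin_mul, hmul, LinearMap.convMul_def, ← LinearMap.comp_assoc, AlgHom.comp_mul',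
      LinearMap.comp_assoc, map_comp_pair]
    rfl

theorem toConv_pair_mul {E C : Type u} [Ring E] [Algebra k E] [AddCommGroup C] [Module k C]
    [Coalgebra k C] (f g : C →ₗ[k] E) :
    toConv f * toConv g = toConv (LinearMap.mul' k E ∘ₗ pair f g) := rfl

variable {L L' A H : Type u} [LieRing L] [LieAlgebra k L] [LieRing L'] [LieAlgebra k L']
  [Ring A] [Bialgebra k A] [Ring H] [Bialgebra k H]
  {ι : L →ₗ[k] A} {ι' : L' →ₗ[k] H}
  {tri0 : L' →ₗ[k] L →ₗ[k] L} {quad0 : L' →ₗ[k] L →ₗ[k] L'}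

namespace IsExtensionHom

variable {R : H →ₐ[k] Module.End k (A ⊗[k] H)}

theorem operator_apply_one (hR : IsExtensionHom ι ι' tri0 quad0 R) (m : A ⊗[k] H) :
    operator R m 1 = m := by
  induction m with
  | zero => simp
  | add u v hu hv => simp only [map_add, LinearMap.add_apply, hu, hv]
  | tmul b y => simp [operator_tmul, hR.apply_one, leftMul_apply]

theorem operator_injective (hR : IsExtensionHom ι ι' tri0 quad0 R) :
    Function.Injective (operator R) := fun m n h => by
  rw [← hR.operator_apply_one m, h, hR.operator_apply_one]

theorem pair_injective {V W C : Type u} [AddCommGroup V] [Module k V] [Coalgebra k V]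
    [AddCommGroup W] [Module k W] [Coalgebra k W] [AddCommGroup C] [Module k C] [Coalgebra k C]
    {hV : HopfStr k V} {hW : HopfStr k W} {a b : hV.Pt C} {h g : hW.Pt C}
    (e : pair a.lin h.lin = pair b.lin g.lin) : a = b ∧ h = g := by
  constructor <;> refine Pt.lin_injective ?_
  · have := congrArg ((cfst k V W : V ⊗[k] W →ₗ[k] V) ∘ₗ ·) e
    exact (cfst_comp_pair a.lin (h : C →ₗc[k] W)).symm.trans
      (this.trans (cfst_comp_pair b.lin (g : C →ₗc[k] W)))
  · have := congrArg ((csnd k V W : V ⊗[k] W →ₗ[k] W) ∘ₗ ·) e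
    exact (csnd_comp_pair (a : C →ₗc[k] V) h.lin).symm.trans
      (this.trans (csnd_comp_pair (b : C →ₗc[k] V) g.lin))

/-- The matched pair of groups of points. -/
noncomputable def points [Coalgebra.IsCocomm k A] [Coalgebra.IsCocomm k H]
    (hι : IsEnveloping ι) (hι' : IsEnveloping ι') (hR : IsExtensionHom ι ι' tri0 quad0 R)
    {hA : HopfStr k A} {hH : HopfStr k H}
    (hAmul : hA.mul = LinearMap.mul' k A) (hAone : hA.one = 1)
    (hHmul : hH.mul = LinearMap.mul' k H) (hHone : hH.one = 1)
    (C : Type u) [AddCommGroup C] [Module k C] [Coalgebra k C] [Coalgebra.IsCocomm k C] :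
    GroupMatchedPair (hA.Pt C) (hH.Pt C) :=
  have h1 (a : hA.Pt C) (h : hH.Pt C) : pointHom hAmul hAone (leftMul k A H) a *
      pointHom hHmul hHone R h = toConv (operator R ∘ₗ pair a.lin h.lin) := by
    change toConv _ * toConv _ = _
    rw [toConv_pair_mul, ← map_comp_pair, ← LinearMap.comp_assoc]
    rfl
  GroupMatchedPair.ofFactorization (pointHom hAmul hAone (leftMul k A H))
    (pointHom hHmul hHone R)
    (fun h a => (cfst k A H).comp ((hR.crossing hι hι').comp (cpair h a)))
    (fun h a => (csnd k A H).comp ((hR.crossing hι hι').comp (cpair h a)))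
    (fun a b h g e => by
      rw [h1, h1] at e
      refine pair_injective (LinearMap.ext fun c => hR.operator_injective ?_)
      exact LinearMap.congr_fun (toConv_injective e) c)
    (fun h a => by
      have h2 : LinearMap.mul' k (Module.End k (A ⊗[k] H)) ∘ₗ
          TensorProduct.map R.toLinearMap (leftMul k A H).toLinearMap =
          operator R ∘ₗ (hR.crossing hι hι' : H ⊗[k] A →ₗ[k] A ⊗[k] H) :=
        TensorProduct.ext' fun h a => hR.mul_leftMul hι hι' h a
      refine Eq.trans ?_ (h1 _ _).symm
      change toConv _ * toConv _ = _
      rw [toConv_pair_mul, ← map_comp_pair, ← LinearMap.comp_assoc, h2, LinearMap.comp_assoc]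
      congr 2
      exact eq_pair_of_comp ((hR.crossing hι hι').comp (cpair h a)))

theorem isMatchedPair [Coalgebra.IsCocomm k A] [Coalgebra.IsCocomm k H]
    (hι : IsEnveloping ι) (hι' : IsEnveloping ι') (hR : IsExtensionHom ι ι' tri0 quad0 R)
    {hA : HopfStr k A} {hH : HopfStr k H}
    (hAmul : hA.mul = LinearMap.mul' k A) (hAone : hA.one = 1)
    (hHmul : hH.mul = LinearMap.mul' k H) (hHone : hH.one = 1) :
    IsMatchedPair hA hH ((cfst k A H).comp (hR.crossing hι hι') : H ⊗[k] A →ₗc[k] A)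
      ((csnd k A H).comp (hR.crossing hι hι') : H ⊗[k] A →ₗc[k] H) :=
  isMatchedPair_of_points hA hH _ _
    (fun C _ _ _ _ => hR.points hι hι' hAmul hAone hHmul hHone C)
    (fun _ _ _ _ _ _ _ => rfl) (fun _ _ _ _ _ _ _ => rfl)

theorem crossing_gen (hι : IsEnveloping ι) (hι' : IsEnveloping ι')
    (hR : IsExtensionHom ι ι' tri0 quad0 R) (x : L') (a : L) :
    hR.crossing hι hι' (ι' x ⊗ₜ ι a) = ι a ⊗ₜ ι' x + ι (tri0 x a) ⊗ₜ 1 + 1 ⊗ₜ ι' (quad0 x a) := by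
  rw [crossing_tmul, ← _root_.mul_one (ι a ⊗ₜ 1 : A ⊗[k] H), hR.apply_gen_mul, hR.apply_one,
    hR.apply_one, _root_.mul_one, Algebra.TensorProduct.tmul_mul_tmul, _root_.mul_one,
    _root_.one_mul]

end IsExtensionHom

theorem exists_isMatchedPair [Coalgebra.IsCocomm k A] [Coalgebra.IsCocomm k H]
    (hι : IsEnveloping ι) (hι' : IsEnveloping ι')
    (htri0 : ∀ (x y : L') (a : L),
      tri0 ⁅x, y⁆ a = tri0 x (tri0 y a) - tri0 y (tri0 x a))
    (hquad0 : ∀ (x : L') (a b : L),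
      quad0 x ⁅a, b⁆ = quad0 (quad0 x a) b - quad0 (quad0 x b) a)
    (hmp1 : ∀ (x : L') (a b : L),
      tri0 x ⁅a, b⁆ =
        ⁅tri0 x a, b⁆ + ⁅a, tri0 x b⁆ + tri0 (quad0 x a) b - tri0 (quad0 x b) a)
    (hmp2 : ∀ (x y : L') (a : L),
      quad0 ⁅x, y⁆ a =
        ⁅quad0 x a, y⁆ + ⁅x, quad0 y a⁆ + quad0 x (tri0 y a) - quad0 y (tri0 x a))
    {hA : HopfStr k A} {hH : HopfStr k H}
    (hAmul : hA.mul = LinearMap.mul' k A) (hAone : hA.one = 1)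
    (hHmul : hH.mul = LinearMap.mul' k H) (hHone : hH.one = 1) :
    ∃ (tri : H ⊗[k] A →ₗ[k] A) (quad : H ⊗[k] A →ₗ[k] H), IsMatchedPair hA hH tri quad ∧
      (∀ x a, tri (ι' x ⊗ₜ ι a) = ι (tri0 x a)) ∧
      (∀ x a, quad (ι' x ⊗ₜ ι a) = ι' (quad0 x a)) := by
  obtain ⟨R, h1, h2, h3⟩ := exists_extension_hom hι hι' htri0 hquad0 hmp1 hmp2
  have hR : IsExtensionHom ι ι' tri0 quad0 R := ⟨h1, h2, h3⟩
  refine ⟨_, _, hR.isMatchedPair hι hι' hAmul hAone hHmul hHone, fun x a => ?_, fun x a => ?_⟩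
  · change cfst k A H (hR.crossing hι hι' (ι' x ⊗ₜ ι a)) = _
    rw [hR.crossing_gen, map_add, map_add, cfst_tmul, cfst_tmul, cfst_tmul, hι'.counit_ι,
      hι'.counit_ι]
    simp
  · change csnd k A H (hR.crossing hι hι' (ι' x ⊗ₜ ι a)) = _
    rw [hR.crossing_gen, map_add, map_add, csnd_tmul, csnd_tmul, csnd_tmul, hι.counit_ι,
      hι.counit_ι]
    simp

end MatchedPairExistence

section MatchedPairUniqueness

open Coalgebra

variable {k}
variable {L L' A H : Type u} [LieRing L] [LieAlgebra k L] [LieRing L'] [LieAlgebra k L']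
  [Ring A] [Bialgebra k A] [Ring H] [Bialgebra k H]
  {ι : L →ₗ[k] A} {ι' : L' →ₗ[k] H}
  {tri0 : L' →ₗ[k] L →ₗ[k] L} {quad0 : L' →ₗ[k] L →ₗ[k] L'}
  {hA : HopfStr k A} {hH : HopfStr k H}
  {tri tri' : H ⊗[k] A →ₗ[k] A} {quad quad' : H ⊗[k] A →ₗ[k] H}

namespace IsMatchedPair

theorem tri_gen_mul (hι : IsEnveloping ι) (hι' : IsEnveloping ι')
    (P : IsMatchedPair hA hH tri quad)
    (hAmul : hA.mul = LinearMap.mul' k A) (hAone : hA.one = 1) (hHone : hH.one = 1)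
    (htri : ∀ x a, tri (ι' x ⊗ₜ ι a) = ι (tri0 x a))
    (hquad : ∀ x a, quad (ι' x ⊗ₜ ι a) = ι' (quad0 x a)) (x : L') (a : L) (b : A) :
    tri (ι' x ⊗ₜ (ι a * b)) =
      ι (tri0 x a) * b + ι a * tri (ι' x ⊗ₜ b) + tri (ι' (quad0 x a) ⊗ₜ b) := by
  have h1 := P.tri_module.one_act
  have h2 := P.quad_module.act_one
  have h3 := P.mp1
  have h4 := P.mp1'
  rw [hHone] at h1 h4
  rw [hAone] at h2 h3
  have h5 := P.mp2 (ι' x) (ι a) b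
  simp only [hAmul, LinearMap.mul'_apply] at h5
  rw [h5, split, hι.comul_ι, hι'.comul_ι]
  simp [TensorProduct.tmul_add, TensorProduct.add_tmul, h1, h2, h3, h4, htri, hquad,
    hι'.counit_ι]

theorem quad_mul_gen (hι : IsEnveloping ι) (P : IsMatchedPair hA hH tri quad)
    (hHmul : hH.mul = LinearMap.mul' k H) (hAone : hA.one = 1)
    (x u : H) (a : L) : quad ((x * u) ⊗ₜ ι a) = LinearMap.mul' k H (rTensor H
      (quad ∘ₗ TensorProduct.mk k H A x ∘ₗ tri ∘ₗ (TensorProduct.mk k H A).flip (ι a))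
        (comul (R := k) u)) + x * quad (u ⊗ₜ ι a) := by
  have h2 := P.quad_module.act_one
  have h3 := P.mp1
  rw [hAone] at h2 h3
  have h5 := P.mp3 x u (ι a)
  simp only [hHmul, LinearMap.mul'_apply] at h5
  rw [h5, split, hι.comul_ι]
  have h6 : u = TensorProduct.lid k H (rTensor H (counit (R := k)) (comul (R := k) u)) := by simp
  conv_rhs => enter [2, 2, 2, 2]; rw [h6]
  generalize comul (R := k) u = Q
  induction Q with
  | zero => simp
  | add u v hu hv =>
    rw [TensorProduct.add_tmul]
    simp only [map_add, TensorProduct.tmul_add _ (TensorProduct.map tri quad _), hu, hv, mul_add,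
      TensorProduct.add_tmul]
    abel
  | tmul p q =>
    simp [TensorProduct.tmul_add, h2, h3, ← TensorProduct.smul_tmul']

theorem eq_of_gen (hι : IsEnveloping ι) (hι' : IsEnveloping ι')
    (P : IsMatchedPair hA hH tri quad) (P' : IsMatchedPair hA hH tri' quad')
    (hAmul : hA.mul = LinearMap.mul' k A) (hAone : hA.one = 1)
    (hHmul : hH.mul = LinearMap.mul' k H) (hHone : hH.one = 1)
    (htri : ∀ x a, tri (ι' x ⊗ₜ ι a) = ι (tri0 x a))
    (hquad : ∀ x a, quad (ι' x ⊗ₜ ι a) = ι' (quad0 x a))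
    (htri' : ∀ x a, tri' (ι' x ⊗ₜ ι a) = ι (tri0 x a))
    (hquad' : ∀ x a, quad' (ι' x ⊗ₜ ι a) = ι' (quad0 x a)) : tri = tri' ∧ quad = quad' := by
  have act {t q} (P : IsMatchedPair hA hH t q) (x y : H) (a : A) :
      t ((x * y) ⊗ₜ a) = t (x ⊗ₜ t (y ⊗ₜ a)) := by
    simpa [hHmul] using P.tri_module.mul_act x y a
  have ract {t q} (P : IsMatchedPair hA hH t q) (x : H) (a b : A) :
      q (x ⊗ₜ (a * b)) = q (q (x ⊗ₜ a) ⊗ₜ b) := by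
    simpa [hAmul] using P.quad_module.act_mul x a b
  have one_act {t q} (P : IsMatchedPair hA hH t q) (a : A) : t (1 ⊗ₜ a) = a := by
    simpa [hHone] using P.tri_module.one_act a
  have ract_one {t q} (P : IsMatchedPair hA hH t q) (x : H) : q (x ⊗ₜ 1) = x := by
    simpa [hAone] using P.quad_module.act_one x
  have act_one {t q} (P : IsMatchedPair hA hH t q) (x : H) :
      t (x ⊗ₜ 1) = counit (R := k) x • 1 := by
    simpa [hAone] using P.mp1 x
  have one_ract {t q} (P : IsMatchedPair hA hH t q) (a : A) :
      q (1 ⊗ₜ a) = counit (R := k) a • 1 := by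
    simpa [hHone] using P.mp1' a
  have ht_gen (b : A) : ∀ x, tri (ι' x ⊗ₜ b) = tri' (ι' x ⊗ₜ b) := by
    refine hι.induction (p := fun b => ∀ x, tri (ι' x ⊗ₜ b) = tri' (ι' x ⊗ₜ b)) ?_ ?_ ?_ ?_ b
    · intro x
      rw [act_one P, act_one P']
    · intro u v hu hv x
      simp only [TensorProduct.tmul_add, map_add, hu, hv]
    · intro c u hu x
      simp only [TensorProduct.tmul_smul, map_smul, hu]
    · intro a u hu x
      rw [P.tri_gen_mul hι hι' hAmul hAone hHone htri hquad, hu, hu,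
        P'.tri_gen_mul hι hι' hAmul hAone hHone htri' hquad']
  have ht : tri = tri' := TensorProduct.ext' fun h => by
    refine hι'.induction (p := fun h => ∀ b, tri (h ⊗ₜ b) = tri' (h ⊗ₜ b)) ?_ ?_ ?_ ?_ h
    · intro b
      rw [one_act P, one_act P']
    · intro u v hu hv b
      simp only [TensorProduct.add_tmul, map_add, hu, hv]
    · intro c u hu b
      simp only [← TensorProduct.smul_tmul', map_smul, hu]
    · intro x u hu b
      rw [act P, act P', hu, ht_gen]
  subst ht
  have hq_gen (b : A) : ∀ x, quad (ι' x ⊗ₜ b) = quad' (ι' x ⊗ₜ b) := by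
    refine hι.induction (p := fun b => ∀ x, quad (ι' x ⊗ₜ b) = quad' (ι' x ⊗ₜ b))
      ?_ ?_ ?_ ?_ b
    · intro x
      rw [ract_one P, ract_one P']
    · intro u v hu hv x
      simp only [TensorProduct.tmul_add, map_add, hu, hv]
    · intro c u hu x
      simp only [TensorProduct.tmul_smul, map_smul, hu]
    · intro a u hu x
      rw [ract P, ract P', hquad, hquad', hu]
  have hq_gen' (h : H) (a : L) : quad (h ⊗ₜ ι a) = quad' (h ⊗ₜ ι a) := by
    refine hι'.induction (p := fun h => quad (h ⊗ₜ ι a) = quad' (h ⊗ₜ ι a)) ?_ ?_ ?_ ?_ h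
    · rw [one_ract P, one_ract P']
    · intro u v hu hv
      simp only [TensorProduct.add_tmul, map_add, hu, hv]
    · intro c u hu
      simp only [← TensorProduct.smul_tmul', map_smul, hu]
    · intro x u hu
      have e : quad ∘ₗ TensorProduct.mk k H A (ι' x) = quad' ∘ₗ TensorProduct.mk k H A (ι' x) :=
        LinearMap.ext fun b => hq_gen b x
      rw [P.quad_mul_gen hι hHmul hAone, P'.quad_mul_gen hι hHmul hAone, hu,
        ← LinearMap.comp_assoc, e, LinearMap.comp_assoc]
  refine ⟨rfl, TensorProduct.ext' fun h b => ?_⟩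
  refine hι.induction (p := fun b => ∀ h, quad (h ⊗ₜ b) = quad' (h ⊗ₜ b)) ?_ ?_ ?_ ?_ b h
  · intro x
    rw [ract_one P, ract_one P']
  · intro u v hu hv x
    simp only [TensorProduct.tmul_add, map_add, hu, hv]
  · intro c u hu x
    simp only [TensorProduct.tmul_smul, map_smul, hu]
  · intro a u hu h
    rw [ract P, ract P', hq_gen', hu]

end IsMatchedPair

end MatchedPairUniqueness

section UniversalEnvelopingAlgebra

open Coalgebra

attribute [local instance] LieRing.ofAssociativeRing

variable {k}
variable {L : Type u} [LieRing L] [LieAlgebra k L]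

theorem universalEnveloping_eq_top (N : Submodule k (UniversalEnvelopingAlgebra k L)) (one : 1 ∈ N)
    (mul : ∀ a, ∀ u ∈ N, UniversalEnvelopingAlgebra.ι k a * u ∈ N) : N = ⊤ := by
  let S : Subalgebra k (UniversalEnvelopingAlgebra k L) :=
    { carrier := {u | ∀ n ∈ N, u * n ∈ N}
      mul_mem' := fun {u v} hu hv n hn => by
        rw [mul_assoc]
        exact hu _ (hv n hn)
      add_mem' := fun {u v} hu hv n hn => by
        rw [add_mul]
        exact N.add_mem (hu n hn) (hv n hn)
      algebraMap_mem' := fun c n hn => by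
        rw [← Algebra.smul_def]
        exact N.smul_mem c hn }
  let f : L →ₗ⁅k⁆ S :=
    { toFun := fun a => ⟨UniversalEnvelopingAlgebra.ι k a, fun u hu => mul a u hu⟩
      map_add' := fun a b => Subtype.ext (map_add _ a b)
      map_smul' := fun c a => Subtype.ext (map_smul _ c a)
      map_lie' := fun {a b} => Subtype.ext (LieHom.map_lie _ a b) }
  have h : S.val.comp (UniversalEnvelopingAlgebra.lift k f) =
      AlgHom.id k (UniversalEnvelopingAlgebra k L) := by
    apply UniversalEnvelopingAlgebra.hom_ext
    ext a
    change ((UniversalEnvelopingAlgebra.lift k f (UniversalEnvelopingAlgebra.ι k a) : S) :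
      UniversalEnvelopingAlgebra k L) = _
    rw [UniversalEnvelopingAlgebra.lift_ι_apply]
    rfl
  refine eq_top_iff.2 fun u _ => ?_
  have h1 : u ∈ S := by
    have h2 : ((UniversalEnvelopingAlgebra.lift k f u : S) : UniversalEnvelopingAlgebra k L) = u :=
      AlgHom.congr_fun h u
    rw [← h2]
    exact (UniversalEnvelopingAlgebra.lift k f u).2
  simpa using h1 1 one

variable [Coalgebra k (UniversalEnvelopingAlgebra k L)]

/-- The bialgebra structure on the enveloping algebra underlying a Hopf structure with the
standard multiplication and unit. -/
@[reducible]
noncomputable def HopfStr.bialgebra (hU : HopfStr k (UniversalEnvelopingAlgebra k L))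
    (hmul : ∀ u v : UniversalEnvelopingAlgebra k L, hU.mul (u ⊗ₜ[k] v) = u * v)
    (hone : hU.one = 1) : Bialgebra k (UniversalEnvelopingAlgebra k L) :=
  Bialgebra.mk' k (UniversalEnvelopingAlgebra k L) (hone ▸ hU.counit_one)
    (fun {a b} => by rw [← hmul, hU.counit_mul])
    (by
      have := hU.comul_one
      rwa [hone] at this)
    (fun {a b} => by
      have h : hU.mul = LinearMap.mul' k (UniversalEnvelopingAlgebra k L) := TensorProduct.ext' hmul
      rw [← hmul, hU.comul_mul, h]
      generalize comul (R := k) a = P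
      generalize comul (R := k) b = Q
      induction P with
      | zero => simp
      | add u v hu hv => simp only [TensorProduct.add_tmul, map_add, add_mul, hu, hv]
      | tmul p q =>
        induction Q with
        | zero => simp
        | add u v hu hv => simp only [TensorProduct.tmul_add, map_add, mul_add, hu, hv]
        | tmul r s => simp)

theorem isEnveloping_ι (hU : HopfStr k (UniversalEnvelopingAlgebra k L))
    (hmul : ∀ u v : UniversalEnvelopingAlgebra k L, hU.mul (u ⊗ₜ[k] v) = u * v) (hone : hU.one = 1)
    (hco : ∀ a : L, comul (R := k) (UniversalEnvelopingAlgebra.ι k a) =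
      UniversalEnvelopingAlgebra.ι k a ⊗ₜ[k] 1 + 1 ⊗ₜ[k] UniversalEnvelopingAlgebra.ι k a)
    (hct : ∀ a : L, counit (R := k) (UniversalEnvelopingAlgebra.ι k a) = 0) :
    letI := hU.bialgebra hmul hone
    IsEnveloping
      (UniversalEnvelopingAlgebra.ι k : L →ₗ⁅k⁆ (UniversalEnvelopingAlgebra k L)).toLinearMap :=
  letI := hU.bialgebra hmul hone
  { map_lie := fun a b => LieHom.map_lie _ a b
    exists_lift := fun f hf =>
      ⟨UniversalEnvelopingAlgebra.lift k { f with map_lie' := fun {a b} => hf a b }, fun a =>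
        UniversalEnvelopingAlgebra.lift_ι_apply k _ a⟩
    eq_top := universalEnveloping_eq_top
    comul_ι := hco
    counit_ι := hct }

end UniversalEnvelopingAlgebra

/-- A matched pair of Lie algebras `(𝔤, 𝔥, ▷, ◁)` extends uniquely to a
matched pair of (cocommutative) Hopf algebras `(U(𝔤), U(𝔥), ▷, ◁)` between the universal
enveloping algebras, and consequently the tensor product coalgebra `U(𝔤) ⊗ U(𝔥)` with the
bicrossed product multiplication `(a ⊗ x)(b ⊗ y) = a(x₍₁₎ ▷ b₍₁₎) ⊗ (x₍₂₎ ◁ b₍₂₎)y` and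
`(a ⊗ x) ∘ (b ⊗ y) = ab ⊗ yx` is a cocommutative Hopf brace.  The standard Hopf algebra
structures of the enveloping algebras (with primitive generators) are taken as hypotheses. -/
theorem statement15 {k : Type u} [Field k]
    {L L' : Type u} [LieRing L] [LieAlgebra k L] [LieRing L'] [LieAlgebra k L']
    (tri0 : L' →ₗ[k] L →ₗ[k] L) (quad0 : L' →ₗ[k] L →ₗ[k] L')
    -- `▷` is a left `𝔥`-module structure on `𝔤`, `◁` a right `𝔤`-module structure on `𝔥`
    (htri0 : ∀ (x y : L') (a : L),
      tri0 ⁅x, y⁆ a = tri0 x (tri0 y a) - tri0 y (tri0 x a))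
    (hquad0 : ∀ (x : L') (a b : L),
      quad0 x ⁅a, b⁆ = quad0 (quad0 x a) b - quad0 (quad0 x b) a)
    -- the matched pair conditions
    (hmp1 : ∀ (x : L') (a b : L),
      tri0 x ⁅a, b⁆ =
        ⁅tri0 x a, b⁆ + ⁅a, tri0 x b⁆ + tri0 (quad0 x a) b - tri0 (quad0 x b) a)
    (hmp2 : ∀ (x y : L') (a : L),
      quad0 ⁅x, y⁆ a =
        ⁅quad0 x a, y⁆ + ⁅x, quad0 y a⁆ + quad0 x (tri0 y a) - quad0 y (tri0 x a))
    -- the Hopf algebra structures of the enveloping algebras, with primitive generators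
    [Coalgebra k (UniversalEnvelopingAlgebra k L)]
    [Coalgebra k (UniversalEnvelopingAlgebra k L')]
    (hcoL : ∀ a : L, Coalgebra.comul (R := k) (UniversalEnvelopingAlgebra.ι k a) =
      UniversalEnvelopingAlgebra.ι k a ⊗ₜ[k] 1 + 1 ⊗ₜ[k] UniversalEnvelopingAlgebra.ι k a)
    (hctL : ∀ a : L, Coalgebra.counit (R := k) (UniversalEnvelopingAlgebra.ι k a) = 0)
    (hcoL' : ∀ x : L', Coalgebra.comul (R := k) (UniversalEnvelopingAlgebra.ι k x) =
      UniversalEnvelopingAlgebra.ι k x ⊗ₜ[k] 1 + 1 ⊗ₜ[k] UniversalEnvelopingAlgebra.ι k x)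
    (hctL' : ∀ x : L', Coalgebra.counit (R := k) (UniversalEnvelopingAlgebra.ι k x) = 0)
    (hU : HopfStr k (UniversalEnvelopingAlgebra k L))
    (hU' : HopfStr k (UniversalEnvelopingAlgebra k L'))
    (hUmul : ∀ u v : UniversalEnvelopingAlgebra k L, hU.mul (u ⊗ₜ[k] v) = u * v)
    (hUone : hU.one = 1)
    (hUanti : ∀ a : L,
      hU.antipode (UniversalEnvelopingAlgebra.ι k a) = -(UniversalEnvelopingAlgebra.ι k a))
    (hU'mul : ∀ u v : UniversalEnvelopingAlgebra k L', hU'.mul (u ⊗ₜ[k] v) = u * v)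
    (hU'one : hU'.one = 1)
    (hU'anti : ∀ x : L',
      hU'.antipode (UniversalEnvelopingAlgebra.ι k x) = -(UniversalEnvelopingAlgebra.ι k x)) :
    -- the actions extend uniquely to a matched pair of Hopf algebras
    (∃! p : (UniversalEnvelopingAlgebra k L' ⊗[k] UniversalEnvelopingAlgebra k L →ₗ[k]
          UniversalEnvelopingAlgebra k L) ×
        (UniversalEnvelopingAlgebra k L' ⊗[k] UniversalEnvelopingAlgebra k L →ₗ[k]
          UniversalEnvelopingAlgebra k L'),
      IsMatchedPair hU hU' p.1 p.2 ∧
      (∀ (x : L') (a : L),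
        p.1 (UniversalEnvelopingAlgebra.ι k x ⊗ₜ[k] UniversalEnvelopingAlgebra.ι k a) =
          UniversalEnvelopingAlgebra.ι k (tri0 x a)) ∧
      (∀ (x : L') (a : L),
        p.2 (UniversalEnvelopingAlgebra.ι k x ⊗ₜ[k] UniversalEnvelopingAlgebra.ι k a) =
          UniversalEnvelopingAlgebra.ι k (quad0 x a))) ∧
    -- and consequently `U(𝔤) ⊗ U(𝔥)` is a cocommutative Hopf brace
    (∀ (tri : UniversalEnvelopingAlgebra k L' ⊗[k] UniversalEnvelopingAlgebra k L →ₗ[k]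
          UniversalEnvelopingAlgebra k L)
        (quad : UniversalEnvelopingAlgebra k L' ⊗[k] UniversalEnvelopingAlgebra k L →ₗ[k]
          UniversalEnvelopingAlgebra k L'),
      IsMatchedPair hU hU' tri quad →
      (∀ (x : L') (a : L),
        tri (UniversalEnvelopingAlgebra.ι k x ⊗ₜ[k] UniversalEnvelopingAlgebra.ι k a) =
          UniversalEnvelopingAlgebra.ι k (tri0 x a)) →
      (∀ (x : L') (a : L),
        quad (UniversalEnvelopingAlgebra.ι k x ⊗ₜ[k] UniversalEnvelopingAlgebra.ι k a) =
          UniversalEnvelopingAlgebra.ι k (quad0 x a)) →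
      ∃ B : HopfBrace k
          (UniversalEnvelopingAlgebra k L ⊗[k] UniversalEnvelopingAlgebra k L'),
        (∀ (a b : UniversalEnvelopingAlgebra k L) (x y : UniversalEnvelopingAlgebra k L'),
          B.dot.mul ((a ⊗ₜ[k] x) ⊗ₜ[k] (b ⊗ₜ[k] y)) =
            sandwich k hU.mul hU'.mul ((a ⊗ₜ[k] matchedEl tri quad x b) ⊗ₜ[k] y)) ∧
        (∀ (a b : UniversalEnvelopingAlgebra k L) (x y : UniversalEnvelopingAlgebra k L'),
          B.circ.mul ((a ⊗ₜ[k] x) ⊗ₜ[k] (b ⊗ₜ[k] y)) =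
            hU.mul (a ⊗ₜ[k] b) ⊗ₜ[k] hU'.mul (y ⊗ₜ[k] x)) ∧
        IsCocomm k (UniversalEnvelopingAlgebra k L ⊗[k] UniversalEnvelopingAlgebra k L')) := by
  let _ := hU.bialgebra hUmul hUone
  let _ := hU'.bialgebra hU'mul hU'one
  have hι := isEnveloping_ι hU hUmul hUone hcoL hctL
  have hι' := isEnveloping_ι hU' hU'mul hU'one hcoL' hctL'
  have := hι.isCocomm
  have := hι'.isCocomm
  have hmul : hU.mul = LinearMap.mul' k (UniversalEnvelopingAlgebra k L) :=
    TensorProduct.ext' hUmul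
  have hmul' : hU'.mul = LinearMap.mul' k (UniversalEnvelopingAlgebra k L') :=
    TensorProduct.ext' hU'mul
  refine ⟨?_, fun tri quad P _ _ => P.exists_brace⟩
  obtain ⟨tri, quad, P, htri, hquad⟩ := exists_isMatchedPair hι hι' htri0 hquad0 hmp1 hmp2
    hmul hUone hmul' hU'one
  refine ⟨(tri, quad), ⟨P, htri, hquad⟩, fun p ⟨P', htri', hquad'⟩ => ?_⟩
  obtain ⟨h₁, h₂⟩ := IsMatchedPair.eq_of_gen hι hι' P' P hmul hUone hmul' hU'one
    htri' hquad' htri hquad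
  exact Prod.ext h₁ h₂

end HopfBraceNL
end

section
/- Let k be a field and let f, g: A → B be two morphisms of Hopf braces over k. Let C be the sum of all subcoalgebras of A contained in the set {a ∈ A | f(a) = g(a)}. Then C is a Hopf subalgebra of A with respect to both Hopf algebra structures of A, hence C is itself a Hopf brace, and the pair (C, i), where i: C → A is the canonical inclusion, is the equalizer of the pair (f, g) in the category of Hopf braces: for every Hopf brace D and every morphism of Hopf braces h: D → A with f ∘ h = g ∘ h, there exists a unique morphism of Hopf braces h': D → C with i ∘ h' = h. -/
/-! Common definitions for formalizing "Constructing Hopf braces" (Agore). -/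

open TensorProduct LinearMap

namespace HopfBraceNL

universe u

variable (k : Type u) [Field k]

section Morphisms

variable {k}
variable {A B : Type u}
  [AddCommGroup A] [Module k A] [Coalgebra k A]
  [AddCommGroup B] [Module k B] [Coalgebra k B]

/-- A morphism of Hopf braces: a `k`-linear map which is a morphism of Hopf algebras for both
Hopf algebra structures (in particular a coalgebra morphism). -/
structure IsHopfBraceHom (BA : HopfBrace k A) (BB : HopfBrace k B) (f : A →ₗ[k] B) : Prop where
  comul_comp : ∀ a : A,
    Coalgebra.comul (R := k) (f a) = TensorProduct.map f f (Coalgebra.comul (R := k) a)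
  counit_comp : ∀ a : A, Coalgebra.counit (R := k) (f a) = Coalgebra.counit (R := k) a
  map_mul : ∀ a b : A, f (BA.dot.mul (a ⊗ₜ[k] b)) = BB.dot.mul (f a ⊗ₜ[k] f b)
  map_one : f BA.dot.one = BB.dot.one
  map_cmul : ∀ a b : A, f (BA.circ.mul (a ⊗ₜ[k] b)) = BB.circ.mul (f a ⊗ₜ[k] f b)
  map_cone : f BA.circ.one = BB.circ.one

/-- A submodule `C ≤ A` is a subcoalgebra if `Δ(C) ⊆ C ⊗ C` (inside `A ⊗ A`). -/
def IsSubcoalgebra (C : Submodule k A) : Prop :=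
  ∀ c ∈ C, Coalgebra.comul (R := k) c ∈
    LinearMap.range (TensorProduct.map C.subtype C.subtype)

/-- The sum of all subcoalgebras of `A` contained in `{a | f a = g a}`. -/
def eqLocusCoalg (f g : A →ₗ[k] B) : Submodule k A :=
  sSup {D : Submodule k A | IsSubcoalgebra D ∧ D ≤ LinearMap.eqLocus f g}

/-- The statement that `(C, i)` (with a suitable coalgebra structure on `C` restricting the one
of `A`) carries a Hopf brace structure making the inclusion the equalizer of `f` and `g` in the
category of Hopf braces. -/
def IsEqualizerSubHopfBrace (BA : HopfBrace k A) (f g : A →ₗ[k] B)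
    (C : Submodule k A) (ic : Coalgebra k ↥C) : Prop :=
  letI := ic
  -- the coalgebra structure on `C` restricts the one of `A`
  (∀ c : ↥C, TensorProduct.map C.subtype C.subtype (Coalgebra.comul (R := k) c) =
      Coalgebra.comul (R := k) (c : A)) ∧
  (∀ c : ↥C, Coalgebra.counit (R := k) c = Coalgebra.counit (R := k) (c : A)) ∧
  -- `C` is a Hopf brace and the inclusion is the equalizer of `(f, g)`
  ∃ BC : HopfBrace k ↥C,
    IsHopfBraceHom BC BA C.subtype ∧
    ∀ (D : Type u) [AddCommGroup D] [Module k D] [Coalgebra k D]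
      (BD : HopfBrace k D) (h : D →ₗ[k] A),
      IsHopfBraceHom BD BA h → f ∘ₗ h = g ∘ₗ h →
      ∃! h' : D →ₗ[k] ↥C, IsHopfBraceHom BD BC h' ∧ C.subtype ∘ₗ h' = h

end Morphisms

open WithConv in
theorem _root_.HopfAlgebra.comul_antipode {R A : Type*} [CommRing R] [Ring A] [HopfAlgebra R A] :
    Coalgebra.comul ∘ₗ HopfAlgebra.antipode R (A := A) =
      TensorProduct.map (HopfAlgebra.antipode R) (HopfAlgebra.antipode R) ∘ₗ
        (TensorProduct.comm R A A).toLinearMap ∘ₗ Coalgebra.comul := by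
  let i₁ : A →ₐ[R] A ⊗[R] A := Algebra.TensorProduct.includeLeft
  let i₂ : A →ₐ[R] A ⊗[R] A := Algebra.TensorProduct.includeRight
  have push (i : A →ₐ[R] A ⊗[R] A) :
      toConv (i.toLinearMap ∘ₗ HopfAlgebra.antipode R) * toConv i.toLinearMap = 1 := by
    have h := algHom_comp_convMul_distrib i
      (toConv (HopfAlgebra.antipode R (A := A))) (toConv LinearMap.id)
    rw [antipode_mul_id, algHom_comp_convOne] at h
    exact (WithConv.ofConv_injective h).symm
  have hΔ : toConv (Coalgebra.comul (R := R) (A := A)) =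
      toConv i₁.toLinearMap * toConv i₂.toLinearMap := by
    ext a
    rw [((Coalgebra.Repr.arbitrary R a)).convMul_apply]
    simp [i₁, i₂, (Coalgebra.Repr.arbitrary R a).eq]
  have hG : toConv (TensorProduct.map (HopfAlgebra.antipode R) (HopfAlgebra.antipode R) ∘ₗ
        (TensorProduct.comm R A A).toLinearMap ∘ₗ Coalgebra.comul) =
      toConv (i₂.toLinearMap ∘ₗ HopfAlgebra.antipode R) *
        toConv (i₁.toLinearMap ∘ₗ HopfAlgebra.antipode R) := by
    ext a
    rw [((Coalgebra.Repr.arbitrary R a)).convMul_apply]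
    simp [i₁, i₂, ← (Coalgebra.Repr.arbitrary R a).eq]
  refine (WithConv.toConv_injective (left_inv_eq_right_inv ?_ comul_right_inv)).symm
  rw [hG, hΔ, mul_assoc, ← mul_assoc (toConv (i₁.toLinearMap ∘ₗ _)), push, one_mul, push]

open WithConv in
theorem _root_.HopfAlgebra.antipode_comp_bialgHom {R A B : Type*} [CommRing R] [Ring A]
    [HopfAlgebra R A] [Ring B] [HopfAlgebra R B] (f : A →ₐc[R] B) :
    HopfAlgebra.antipode R ∘ₗ f.toLinearMap = f.toLinearMap ∘ₗ HopfAlgebra.antipode R := by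
  refine WithConv.toConv_injective
    (left_inv_eq_right_inv (a := toConv f.toLinearMap) ?_ ?_)
  · have h := convMul_comp_coalgHom_distrib (toConv (HopfAlgebra.antipode R (A := B)))
      (toConv LinearMap.id) f.toCoalgHom
    rw [antipode_mul_id, convOne_comp_coalgHom] at h
    exact (WithConv.ofConv_injective h).symm
  · have h := algHom_comp_convMul_distrib (f : A →ₐ[R] B) (toConv LinearMap.id)
      (toConv (HopfAlgebra.antipode R (A := A)))
    rw [id_mul_antipode, algHom_comp_convOne] at h
    exact (WithConv.ofConv_injective h).symm

namespace HopfStr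

variable {k} {V W : Type u} [AddCommGroup V] [Module k V] [Coalgebra k V]
  [AddCommGroup W] [Module k W] [Coalgebra k W]

/-- The ring underlying a Hopf structure. -/
abbrev ring (hs : HopfStr k V) : Ring V where
  mul a b := hs.mul (a ⊗ₜ[k] b)
  one := hs.one
  mul_assoc := hs.mul_assoc
  one_mul := hs.one_mul
  mul_one := hs.mul_one
  left_distrib a b c := by
    change hs.mul (a ⊗ₜ[k] (b + c)) = hs.mul (a ⊗ₜ[k] b) + hs.mul (a ⊗ₜ[k] c)
    rw [TensorProduct.tmul_add, map_add]
  right_distrib a b c := by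
    change hs.mul ((a + b) ⊗ₜ[k] c) = hs.mul (a ⊗ₜ[k] c) + hs.mul (b ⊗ₜ[k] c)
    rw [TensorProduct.add_tmul, map_add]
  zero_mul a := by
    change hs.mul (0 ⊗ₜ[k] a) = 0
    rw [TensorProduct.zero_tmul, map_zero]
  mul_zero a := by
    change hs.mul (a ⊗ₜ[k] 0) = 0
    rw [TensorProduct.tmul_zero, map_zero]
  neg_add_cancel := neg_add_cancel
  sub_eq_add_neg := sub_eq_add_neg
  zsmul := zsmulRec

/-- The algebra underlying a Hopf structure. -/
abbrev algebra (hs : HopfStr k V) : letI := hs.ring; Algebra k V :=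
  letI := hs.ring
  Algebra.ofModule
    (fun r x y => by
      change hs.mul ((r • x) ⊗ₜ[k] y) = r • hs.mul (x ⊗ₜ[k] y)
      rw [← TensorProduct.smul_tmul', map_smul])
    (fun r x y => by
      change hs.mul (x ⊗ₜ[k] (r • y)) = r • hs.mul (x ⊗ₜ[k] y)
      rw [TensorProduct.tmul_smul, map_smul])

theorem mul'_eq (hs : HopfStr k V) :
    letI := hs.ring; letI := hs.algebra; LinearMap.mul' k V = hs.mul := by
  let := hs.ring; let := hs.algebra
  exact TensorProduct.ext' fun _ _ => rfl

/-- The Mathlib Hopf algebra underlying a Hopf structure. -/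
abbrev hopfAlgebra (hs : HopfStr k V) : letI := hs.ring; HopfAlgebra k V :=
  letI := hs.ring
  letI := hs.algebra
  letI : Bialgebra k V := Bialgebra.mk' k V hs.counit_one (hs.counit_mul _ _) hs.comul_one
    (by
      intro a b
      refine (hs.comul_mul a b).trans ?_
      have key : TensorProduct.map hs.mul hs.mul ∘ₗ
            (TensorProduct.tensorTensorTensorComm k V V V V).toLinearMap =
          LinearMap.mul' k (V ⊗[k] V) := by
        ext a b c d
        exact (Algebra.TensorProduct.tmul_mul_tmul (R := k) a c b d).symm
      exact LinearMap.congr_fun key _)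
  { antipode := hs.antipode
    mul_antipode_rTensor_comul := by
      rw [hs.mul'_eq]
      exact hs.antipode_left
    mul_antipode_lTensor_comul := by
      rw [hs.mul'_eq]
      exact hs.antipode_right }

theorem comul_antipode (hs : HopfStr k V) (a : V) :
    Coalgebra.comul (R := k) (hs.antipode a) =
      TensorProduct.map hs.antipode hs.antipode
        (TensorProduct.comm k V V (Coalgebra.comul (R := k) a)) := by
  let := hs.ring
  let := hs.hopfAlgebra
  exact LinearMap.congr_fun (HopfAlgebra.comul_antipode (R := k) (A := V)) a

theorem map_antipode (hV : HopfStr k V) (hW : HopfStr k W) (f : V →ₗ[k] W)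
    (comul_comp : ∀ a : V,
      Coalgebra.comul (R := k) (f a) = TensorProduct.map f f (Coalgebra.comul (R := k) a))
    (counit_comp : ∀ a : V, Coalgebra.counit (R := k) (f a) = Coalgebra.counit (R := k) a)
    (map_mul : ∀ a b : V, f (hV.mul (a ⊗ₜ[k] b)) = hW.mul (f a ⊗ₜ[k] f b))
    (map_one : f hV.one = hW.one) (a : V) :
    f (hV.antipode a) = hW.antipode (f a) := by
  let := hV.ring
  let := hV.hopfAlgebra
  let := hW.ring
  let := hW.hopfAlgebra
  let F : V →ₐc[k] W := .ofAlgHom (AlgHom.ofLinearMap f map_one map_mul)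
    (by ext a; exact counit_comp a) (by ext a; exact (comul_comp a).symm)
  exact (LinearMap.congr_fun (HopfAlgebra.antipode_comp_bialgHom F) a).symm

end HopfStr

section Restriction

variable {k}
variable {M A B C : Type u} [AddCommGroup M] [Module k M] [AddCommGroup A] [Module k A]
  [AddCommGroup B] [Module k B] [AddCommGroup C] [Module k C]

theorem map_injective {M' : Type u} [AddCommGroup M'] [Module k M'] {i : M →ₗ[k] A}
    {j : M' →ₗ[k] B} (hi : Function.Injective i) (hj : Function.Injective j) :
    Function.Injective (TensorProduct.map i j) :=
  TensorProduct.map_injective_of_flat_flat i j hi hj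

theorem range_map_le_of_le {p q : Submodule k A} (h : p ≤ q) :
    LinearMap.range (TensorProduct.map p.subtype p.subtype) ≤
      LinearMap.range (TensorProduct.map q.subtype q.subtype) := by
  rintro _ ⟨x, rfl⟩
  refine ⟨TensorProduct.map (Submodule.inclusion h) (Submodule.inclusion h) x, ?_⟩
  rw [TensorProduct.map_map]
  rfl

variable [Coalgebra k A]

theorem isSubcoalgebra_sSup {S : Set (Submodule k A)} (hS : ∀ D ∈ S, IsSubcoalgebra D) :
    IsSubcoalgebra (sSup S) := by
  suffices sSup S ≤ (LinearMap.range (TensorProduct.map (sSup S).subtype (sSup S).subtype)).comap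
      Coalgebra.comul from fun c hc => this hc
  exact sSup_le fun D hD c hc => range_map_le_of_le (le_sSup hD) (hS D hD c hc)

theorem isSubcoalgebra_range {φ : M →ₗ[k] A}
    (h : ∀ m, Coalgebra.comul (R := k) (φ m) ∈ LinearMap.range (TensorProduct.map φ φ)) :
    IsSubcoalgebra (LinearMap.range φ) := by
  rintro _ ⟨m, rfl⟩
  obtain ⟨x, hx⟩ := h m
  refine ⟨TensorProduct.map φ.rangeRestrict φ.rangeRestrict x, ?_⟩
  rw [TensorProduct.map_map, ← hx]
  rfl

theorem isSubcoalgebra_eqLocusCoalg (f g : A →ₗ[k] B) : IsSubcoalgebra (eqLocusCoalg f g) :=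
  isSubcoalgebra_sSup fun _ hD => hD.1

theorem eqLocusCoalg_le (f g : A →ₗ[k] B) : eqLocusCoalg f g ≤ LinearMap.eqLocus f g :=
  sSup_le fun _ hD => hD.2

theorem mem_eqLocusCoalg_of_range {f g : A →ₗ[k] B} {φ : M →ₗ[k] A}
    (h : ∀ m, Coalgebra.comul (R := k) (φ m) ∈ LinearMap.range (TensorProduct.map φ φ))
    (hfg : f ∘ₗ φ = g ∘ₗ φ) (m : M) : φ m ∈ eqLocusCoalg f g := by
  have hle : LinearMap.range φ ≤ eqLocusCoalg f g :=
    le_sSup ⟨isSubcoalgebra_range h, by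
      rintro _ ⟨m, rfl⟩
      exact LinearMap.congr_fun hfg m⟩
  exact hle ⟨m, rfl⟩

theorem IsSubcoalgebra.comul_mul_mem {D : Submodule k A} (hD : IsSubcoalgebra D)
    (hs : HopfStr k A) (x : D ⊗[k] D) :
    Coalgebra.comul (R := k) ((hs.mul ∘ₗ TensorProduct.map D.subtype D.subtype) x) ∈
      LinearMap.range (TensorProduct.map (hs.mul ∘ₗ TensorProduct.map D.subtype D.subtype)
        (hs.mul ∘ₗ TensorProduct.map D.subtype D.subtype)) := by
  induction x with
  | zero => simp
  | add x y hx hy => rw [map_add, map_add]; exact add_mem hx hy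
  | tmul a b =>
    obtain ⟨u, hu⟩ := hD a a.2
    obtain ⟨v, hv⟩ := hD b b.2
    refine ⟨TensorProduct.tensorTensorTensorComm k D D D D (u ⊗ₜ[k] v), ?_⟩
    have h := LinearMap.congr_fun (TensorProduct.tensorTensorTensorComm_comp_map
      k D.subtype D.subtype D.subtype D.subtype) (u ⊗ₜ[k] v)
    simp only [LinearMap.comp_apply, LinearEquiv.coe_coe, TensorProduct.map_tmul, hu, hv] at h
    rw [TensorProduct.map_comp, LinearMap.comp_apply, LinearMap.comp_apply,
      TensorProduct.map_tmul, Submodule.subtype_apply, Submodule.subtype_apply, hs.comul_mul]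
    exact congrArg _ h.symm

theorem mul_mem_eqLocusCoalg {f g : A →ₗ[k] B} (hs : HopfStr k A) (m : B ⊗[k] B →ₗ[k] B)
    (hf : ∀ a b : A, f (hs.mul (a ⊗ₜ[k] b)) = m (f a ⊗ₜ[k] f b))
    (hg : ∀ a b : A, g (hs.mul (a ⊗ₜ[k] b)) = m (g a ⊗ₜ[k] g b))
    {a b : A} (ha : a ∈ eqLocusCoalg f g) (hb : b ∈ eqLocusCoalg f g) :
    hs.mul (a ⊗ₜ[k] b) ∈ eqLocusCoalg f g := by
  refine mem_eqLocusCoalg_of_range (f := f) (g := g)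
    ((isSubcoalgebra_eqLocusCoalg f g).comul_mul_mem hs) (TensorProduct.ext' fun x y => ?_)
    (⟨a, ha⟩ ⊗ₜ[k] ⟨b, hb⟩)
  have hx : f x = g x := eqLocusCoalg_le f g x.2
  have hy : f y = g y := eqLocusCoalg_le f g y.2
  simp [hf, hg, hx, hy]

theorem one_mem_eqLocusCoalg {f g : A →ₗ[k] B} (hs : HopfStr k A) (h : f hs.one = g hs.one) :
    hs.one ∈ eqLocusCoalg f g := by
  have := mem_eqLocusCoalg_of_range (f := f) (g := g) (φ := toSpanSingleton k A hs.one)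
    (fun r => ⟨r ⊗ₜ[k] 1, by simp [hs.comul_one, TensorProduct.smul_tmul']⟩)
    (by ext; simpa using h) 1
  simpa using this

theorem antipode_mem_eqLocusCoalg {f g : A →ₗ[k] B} (hs : HopfStr k A) (S : B →ₗ[k] B)
    (hf : ∀ a : A, f (hs.antipode a) = S (f a)) (hg : ∀ a : A, g (hs.antipode a) = S (g a))
    {a : A} (ha : a ∈ eqLocusCoalg f g) : hs.antipode a ∈ eqLocusCoalg f g := by
  refine mem_eqLocusCoalg_of_range (f := f) (g := g)
    (φ := hs.antipode ∘ₗ (eqLocusCoalg f g).subtype) (fun c => ?_)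
    (LinearMap.ext fun c => ?_) ⟨a, ha⟩
  · obtain ⟨u, hu⟩ := isSubcoalgebra_eqLocusCoalg f g c c.2
    refine ⟨TensorProduct.comm k _ _ u, ?_⟩
    rw [LinearMap.comp_apply, Submodule.subtype_apply, hs.comul_antipode, ← hu,
      TensorProduct.map_comp, LinearMap.comp_apply, TensorProduct.map_comm]
  · have hc : f c = g c := eqLocusCoalg_le f g c.2
    simp [hf, hg, hc]

section Coalgebra

/-- The comultiplication of `A` restricted to a subcoalgebra. -/
noncomputable def IsSubcoalgebra.comul {D : Submodule k A} (hD : IsSubcoalgebra D) :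
    D →ₗ[k] D ⊗[k] D :=
  (LinearEquiv.ofInjective (TensorProduct.map D.subtype D.subtype)
      (map_injective D.subtype_injective D.subtype_injective)).symm.toLinearMap ∘ₗ
    (Coalgebra.comul ∘ₗ D.subtype).codRestrict _ fun c => hD c c.2

theorem IsSubcoalgebra.map_comul {D : Submodule k A} (hD : IsSubcoalgebra D) (c : D) :
    TensorProduct.map D.subtype D.subtype (hD.comul c) = Coalgebra.comul (R := k) (c : A) := by
  have := LinearEquiv.apply_symm_apply (LinearEquiv.ofInjective
    (TensorProduct.map D.subtype D.subtype)
    (map_injective D.subtype_injective D.subtype_injective)) ⟨_, hD c c.2⟩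
  exact congrArg Subtype.val this

theorem map_map_lTensor {δ : C →ₗ[k] C ⊗[k] C} {i : C →ₗ[k] A}
    (h : ∀ c, TensorProduct.map i i (δ c) = Coalgebra.comul (R := k) (i c)) (x : C ⊗[k] C) :
    TensorProduct.map i (TensorProduct.map i i) (lTensor C δ x) =
      lTensor A Coalgebra.comul (TensorProduct.map i i x) := by
  induction x with
  | zero => simp
  | add x y hx hy => simp only [map_add, hx, hy]
  | tmul a b => simp [h]

/-- The coalgebra structure of a subcoalgebra. -/
noncomputable abbrev IsSubcoalgebra.coalgebra {D : Submodule k A} (hD : IsSubcoalgebra D) :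
    Coalgebra k D where
  comul := hD.comul
  counit := Coalgebra.counit ∘ₗ D.subtype
  coassoc := by
    ext c
    apply map_injective D.subtype_injective
      (map_injective D.subtype_injective D.subtype_injective)
    have key (x : D ⊗[k] D) : TensorProduct.map D.subtype (TensorProduct.map D.subtype D.subtype)
        (TensorProduct.assoc k D D D (rTensor D hD.comul x)) =
        TensorProduct.assoc k A A A
          (rTensor A Coalgebra.comul (TensorProduct.map D.subtype D.subtype x)) := by
      induction x with
      | zero => simp
      | add x y hx hy => simp only [map_add, hx, hy]
      | tmul a b => simp [TensorProduct.map_map_assoc, hD.map_comul]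
    simp only [LinearMap.comp_apply, LinearEquiv.coe_coe, key, map_map_lTensor hD.map_comul,
      hD.map_comul, Coalgebra.coassoc_apply]
  rTensor_counit_comp_comul := by
    ext c
    apply map_injective (i := LinearMap.id) Function.injective_id D.subtype_injective
    have key (x : D ⊗[k] D) : TensorProduct.map LinearMap.id D.subtype
        (rTensor D (Coalgebra.counit ∘ₗ D.subtype) x) =
        rTensor A Coalgebra.counit (TensorProduct.map D.subtype D.subtype x) := by
      rw [rTensor, rTensor, TensorProduct.map_map, TensorProduct.map_map]
      rfl
    simp only [LinearMap.comp_apply, key, hD.map_comul, Coalgebra.rTensor_counit_comul]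
    simp
  lTensor_counit_comp_comul := by
    ext c
    apply map_injective (j := LinearMap.id) D.subtype_injective Function.injective_id
    have key (x : D ⊗[k] D) : TensorProduct.map D.subtype LinearMap.id
        (lTensor D (Coalgebra.counit ∘ₗ D.subtype) x) =
        lTensor A Coalgebra.counit (TensorProduct.map D.subtype D.subtype x) := by
      rw [lTensor, lTensor, TensorProduct.map_map, TensorProduct.map_map]
      rfl
    simp only [LinearMap.comp_apply, key, hD.map_comul, Coalgebra.lTensor_counit_comul]
    simp

end Coalgebra

variable [Coalgebra k C]

/-- A Hopf structure restricts along an injective coalgebra map whose image is closed under the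
operations. -/
abbrev HopfStr.restrict (hs : HopfStr k A) {i : C →ₗ[k] A} (hi : Function.Injective i)
    (hΔ : ∀ c, TensorProduct.map i i (Coalgebra.comul (R := k) c) = Coalgebra.comul (R := k) (i c))
    (hε : ∀ c, Coalgebra.counit (R := k) c = Coalgebra.counit (R := k) (i c))
    (m : C ⊗[k] C →ₗ[k] C) (hm : ∀ x, i (m x) = hs.mul (TensorProduct.map i i x))
    (e : C) (he : i e = hs.one)
    (S : C →ₗ[k] C) (hS : ∀ c, i (S c) = hs.antipode (i c)) : HopfStr k C where
  mul := m
  one := e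
  mul_assoc a b c := hi (by simp [hm, hs.mul_assoc])
  one_mul a := hi (by simp [hm, he, hs.one_mul])
  mul_one a := hi (by simp [hm, he, hs.mul_one])
  comul_mul a b := by
    apply map_injective hi hi
    have hmm : i ∘ₗ m = hs.mul ∘ₗ TensorProduct.map i i := LinearMap.ext hm
    have h := LinearMap.congr_fun (TensorProduct.tensorTensorTensorComm_comp_map k i i i i)
      (Coalgebra.comul (R := k) a ⊗ₜ[k] Coalgebra.comul (R := k) b)
    simp only [LinearMap.comp_apply, LinearEquiv.coe_coe, TensorProduct.map_tmul, hΔ] at h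
    rw [hΔ, hm, TensorProduct.map_tmul, hs.comul_mul, h, TensorProduct.map_map,
      TensorProduct.map_map, hmm]
  counit_mul a b := by simp [hε, hm, hs.counit_mul]
  comul_one := by
    apply map_injective hi hi
    rw [hΔ, he, hs.comul_one, TensorProduct.map_tmul, he]
  counit_one := by rw [hε, he, hs.counit_one]
  antipode := S
  antipode_left := by
    ext c
    apply hi
    have key (x : C ⊗[k] C) : TensorProduct.map i i (rTensor C S x) =
        rTensor A hs.antipode (TensorProduct.map i i x) := by
      rw [rTensor, rTensor, TensorProduct.map_map, TensorProduct.map_map,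
        show i ∘ₗ S = hs.antipode ∘ₗ i from LinearMap.ext hS]
      rfl
    simpa [hm, key, hΔ, hε, he] using LinearMap.congr_fun hs.antipode_left (i c)
  antipode_right := by
    ext c
    apply hi
    have key (x : C ⊗[k] C) : TensorProduct.map i i (lTensor C S x) =
        lTensor A hs.antipode (TensorProduct.map i i x) := by
      rw [lTensor, lTensor, TensorProduct.map_map, TensorProduct.map_map,
        show i ∘ₗ S = hs.antipode ∘ₗ i from LinearMap.ext hS]
      rfl
    simpa [hm, key, hΔ, hε, he] using LinearMap.congr_fun hs.antipode_right (i c)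

theorem map_braceRHS {i : C →ₗ[k] A}
    (hΔ : ∀ c, TensorProduct.map i i (Coalgebra.comul (R := k) c) = Coalgebra.comul (R := k) (i c))
    {m m' : C ⊗[k] C →ₗ[k] C} {S : C →ₗ[k] C} {n n' : A ⊗[k] A →ₗ[k] A} {T : A →ₗ[k] A}
    (hm : ∀ x, i (m x) = n (TensorProduct.map i i x))
    (hm' : ∀ x, i (m' x) = n' (TensorProduct.map i i x))
    (hS : ∀ c, i (S c) = T (i c)) (x y z : C) :
    i (braceRHS m S m' (x ⊗ₜ[k] (y ⊗ₜ[k] z))) =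
      braceRHS n T n' (i x ⊗ₜ[k] (i y ⊗ₜ[k] i z)) := by
  simp only [braceRHS, LinearMap.comp_apply, rTensor_tmul, ← hΔ, ← map_map_lTensor hΔ]
  generalize lTensor C Coalgebra.comul (Coalgebra.comul (R := k) x) = u
  induction u with
  | zero => simp
  | add u v hu hv => simp only [map_add, TensorProduct.add_tmul, hu, hv]
  | tmul a w =>
    induction w with
    | zero => simp
    | add u v hu hv => simp only [map_add, TensorProduct.tmul_add, TensorProduct.add_tmul, hu, hv]
    | tmul b c => simp [hm, hm', hS]

end Restriction

section SubHopfBrace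

variable {k}
variable {A : Type u} [AddCommGroup A] [Module k A] [Coalgebra k A]

/-- A bilinear operation restricted to a submodule closed under it. -/
noncomputable def restrictMul {D : Submodule k A} (m : A ⊗[k] A →ₗ[k] A)
    (h : ∀ a b : A, a ∈ D → b ∈ D → m (a ⊗ₜ[k] b) ∈ D) : D ⊗[k] D →ₗ[k] D :=
  (m ∘ₗ TensorProduct.map D.subtype D.subtype).codRestrict D fun x => by
    induction x with
    | zero => simp
    | add x y hx hy => rw [map_add]; exact add_mem hx hy
    | tmul a b => exact h a b a.2 b.2

/-- The Hopf structure of a Hopf subalgebra. -/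
noncomputable abbrev IsSubcoalgebra.hopfStr {D : Submodule k A} (hD : IsSubcoalgebra D)
    (hs : HopfStr k A) (mul_mem : ∀ a b : A, a ∈ D → b ∈ D → hs.mul (a ⊗ₜ[k] b) ∈ D)
    (one_mem : hs.one ∈ D) (antipode_mem : ∀ a ∈ D, hs.antipode a ∈ D) :
    letI := hD.coalgebra; HopfStr k D :=
  letI := hD.coalgebra
  hs.restrict D.subtype_injective hD.map_comul (fun _ => rfl)
    (restrictMul hs.mul mul_mem) (fun _ => rfl) ⟨hs.one, one_mem⟩ rfl
    (hs.antipode.restrict antipode_mem) (fun _ => rfl)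

/-- The Hopf brace structure of a subcoalgebra closed under all operations. -/
noncomputable abbrev IsSubcoalgebra.hopfBrace {D : Submodule k A} (hD : IsSubcoalgebra D)
    (BA : HopfBrace k A) (dot_mul : ∀ a b : A, a ∈ D → b ∈ D → BA.dot.mul (a ⊗ₜ[k] b) ∈ D)
    (dot_one : BA.dot.one ∈ D) (dot_antipode : ∀ a ∈ D, BA.dot.antipode a ∈ D)
    (circ_mul : ∀ a b : A, a ∈ D → b ∈ D → BA.circ.mul (a ⊗ₜ[k] b) ∈ D)
    (circ_one : BA.circ.one ∈ D) (circ_antipode : ∀ a ∈ D, BA.circ.antipode a ∈ D) :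
    letI := hD.coalgebra; HopfBrace k D :=
  letI := hD.coalgebra
  { dot := hD.hopfStr BA.dot dot_mul dot_one dot_antipode
    circ := hD.hopfStr BA.circ circ_mul circ_one circ_antipode
    brace := by
      refine TensorProduct.ext' fun x w => ?_
      induction w with
      | zero => simp
      | add u v hu hv => rw [TensorProduct.tmul_add, map_add, map_add, hu, hv]
      | tmul y z =>
        apply D.subtype_injective
        rw [map_braceRHS (i := D.subtype) hD.map_comul (fun _ => rfl) (fun _ => rfl) (fun _ => rfl)]
        exact LinearMap.congr_fun BA.brace ((x : A) ⊗ₜ[k] ((y : A) ⊗ₜ[k] (z : A))) }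

end SubHopfBrace

/-- Let `f, g : A → B` be morphisms of Hopf braces and let `C` be the sum of
all subcoalgebras of `A` contained in `{a | f a = g a}`.  Then `C` is a Hopf subalgebra of `A`
for both Hopf algebra structures, hence a Hopf brace, and `(C, i)` is the equalizer of `(f, g)`
in the category of Hopf braces. -/
theorem statement17 {k : Type u} [Field k]
    {A B : Type u} [AddCommGroup A] [Module k A] [Coalgebra k A]
    [AddCommGroup B] [Module k B] [Coalgebra k B]
    (BA : HopfBrace k A) (BB : HopfBrace k B) (f g : A →ₗ[k] B)
    (hf : IsHopfBraceHom BA BB f) (hg : IsHopfBraceHom BA BB g) :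
    -- `C` is a subcoalgebra contained in the equalizer of `f` and `g`
    IsSubcoalgebra (eqLocusCoalg f g) ∧
    eqLocusCoalg f g ≤ LinearMap.eqLocus f g ∧
    -- `C` is a Hopf subalgebra with respect to both Hopf algebra structures of `A`
    (∀ a b : A, a ∈ eqLocusCoalg f g → b ∈ eqLocusCoalg f g →
      BA.dot.mul (a ⊗ₜ[k] b) ∈ eqLocusCoalg f g) ∧
    BA.dot.one ∈ eqLocusCoalg f g ∧
    (∀ a ∈ eqLocusCoalg f g, BA.dot.antipode a ∈ eqLocusCoalg f g) ∧
    (∀ a b : A, a ∈ eqLocusCoalg f g → b ∈ eqLocusCoalg f g →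
      BA.circ.mul (a ⊗ₜ[k] b) ∈ eqLocusCoalg f g) ∧
    BA.circ.one ∈ eqLocusCoalg f g ∧
    (∀ a ∈ eqLocusCoalg f g, BA.circ.antipode a ∈ eqLocusCoalg f g) ∧
    -- hence `C` is a Hopf brace and `(C, i)` is the equalizer of `(f, g)`
    ∃ ic : Coalgebra k ↥(eqLocusCoalg f g),
      IsEqualizerSubHopfBrace BA f g (eqLocusCoalg f g) ic := by
  have hC := isSubcoalgebra_eqLocusCoalg f g
  have dot_mul (a b : A) (ha : a ∈ eqLocusCoalg f g) (hb : b ∈ eqLocusCoalg f g) :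
      BA.dot.mul (a ⊗ₜ[k] b) ∈ eqLocusCoalg f g :=
    mul_mem_eqLocusCoalg BA.dot BB.dot.mul hf.map_mul hg.map_mul ha hb
  have circ_mul (a b : A) (ha : a ∈ eqLocusCoalg f g) (hb : b ∈ eqLocusCoalg f g) :
      BA.circ.mul (a ⊗ₜ[k] b) ∈ eqLocusCoalg f g :=
    mul_mem_eqLocusCoalg BA.circ BB.circ.mul hf.map_cmul hg.map_cmul ha hb
  have dot_one : BA.dot.one ∈ eqLocusCoalg f g :=
    one_mem_eqLocusCoalg BA.dot (hf.map_one.trans hg.map_one.symm)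
  have circ_one : BA.circ.one ∈ eqLocusCoalg f g :=
    one_mem_eqLocusCoalg BA.circ (hf.map_cone.trans hg.map_cone.symm)
  have dot_antipode (a : A) (ha : a ∈ eqLocusCoalg f g) :
      BA.dot.antipode a ∈ eqLocusCoalg f g :=
    antipode_mem_eqLocusCoalg BA.dot BB.dot.antipode
      (BA.dot.map_antipode BB.dot f hf.comul_comp hf.counit_comp hf.map_mul hf.map_one)
      (BA.dot.map_antipode BB.dot g hg.comul_comp hg.counit_comp hg.map_mul hg.map_one) ha
  have circ_antipode (a : A) (ha : a ∈ eqLocusCoalg f g) :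
      BA.circ.antipode a ∈ eqLocusCoalg f g :=
    antipode_mem_eqLocusCoalg BA.circ BB.circ.antipode
      (BA.circ.map_antipode BB.circ f hf.comul_comp hf.counit_comp hf.map_cmul hf.map_cone)
      (BA.circ.map_antipode BB.circ g hg.comul_comp hg.counit_comp hg.map_cmul hg.map_cone) ha
  refine ⟨hC, eqLocusCoalg_le f g, dot_mul, dot_one, dot_antipode, circ_mul, circ_one,
    circ_antipode, hC.coalgebra, hC.map_comul, fun _ => rfl, ?_⟩
  let := hC.coalgebra
  refine ⟨hC.hopfBrace BA dot_mul dot_one dot_antipode circ_mul circ_one circ_antipode,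
    ⟨fun c => (hC.map_comul c).symm, fun _ => rfl, fun _ _ => rfl, rfl, fun _ _ => rfl, rfl⟩, ?_⟩
  intro D _ _ _ BD h hh hfg
  have hmem (d : D) : h d ∈ eqLocusCoalg f g :=
    mem_eqLocusCoalg_of_range (fun d => ⟨_, (hh.comul_comp d).symm⟩) hfg d
  refine ⟨h.codRestrict _ hmem, ⟨⟨fun d => ?_, hh.counit_comp,
    fun a b => Subtype.ext (hh.map_mul a b), Subtype.ext hh.map_one,
    fun a b => Subtype.ext (hh.map_cmul a b), Subtype.ext hh.map_cone⟩, rfl⟩, ?_⟩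
  · apply map_injective (eqLocusCoalg f g).subtype_injective (eqLocusCoalg f g).subtype_injective
    rw [TensorProduct.map_map]
    exact (hC.map_comul _).trans (hh.comul_comp d)
  · rintro h' ⟨-, hh'⟩
    exact LinearMap.ext fun d => Subtype.ext (LinearMap.congr_fun hh' d)

end HopfBraceNL
end
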